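/- arXiv:1804.00990 — 3 statements merged into one kernel-verified Lean document; each statement's English description precedes it below -/
import Mathlib

section
/- Let n ≥ 2 and d ≥ n, and let ω be the weight vector with ω_i = n−1 for 1 ≤ i ≤ d, ω_{d+1} = 1, ω_i = 0 for i > d+1 (this is ω(X_1^{2^d−1} x_1^{2^d})). Then Y_1 := Σ_{u=1}^{n} φ_{(1;I_1)}(X^{2^d−1}) x_u^{2^d} ∈ A_n^+P_n + P_n^−(ω); that is, Y_1 can be written as Σ_{0≤i<n} Sq^{2^i}(y_i) + h with y_i ∈ P_n and h ∈ P_n^−(ω). -/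
open MvPolynomial

noncomputable section

/-- `P n` is the polynomial algebra `F_2[x_1, …, x_n]`, with `x_{k+1}` corresponding to
the variable indexed by `k : Fin n`. -/
abbrev P (n : ℕ) : Type := MvPolynomial (Fin n) (ZMod 2)

/-- The total Steenrod square, the ring homomorphism determined by `x_i ↦ x_i + x_i^2`. -/
def sqTot (n : ℕ) : P n →ₐ[ZMod 2] P n := bind₁ fun i => X i + X i ^ 2

/-- The Steenrod square `Sq^k`: on a homogeneous polynomial of degree `d` it is the
homogeneous component of degree `d + k` of the total square, extended additively. -/
def SqK (n k : ℕ) (f : P n) : P n :=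
  ∑ d ∈ Finset.range (f.totalDegree + 1),
    homogeneousComponent (d + k) (sqTot n (homogeneousComponent d f))

/-- `A^+ P_n = Σ_{j ≥ 1} Sq^j(P_n)`, the submodule of hit polynomials. -/
def hitS (n : ℕ) : Submodule (ZMod 2) (P n) :=
  Submodule.span (ZMod 2) {g | ∃ j, 1 ≤ j ∧ ∃ h, g = SqK n j h}

/-- `A_s^+ P_n = Σ_{1 ≤ j < 2^s} Sq^j(P_n)`. -/
def AplusS (n s : ℕ) : Submodule (ZMod 2) (P n) :=
  Submodule.span (ZMod 2) {g | ∃ j, 1 ≤ j ∧ j < 2 ^ s ∧ ∃ h, g = SqK n j h}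

/-- Degree of a monomial given by its exponent vector. -/
def mdeg {n : ℕ} (a : Fin n →₀ ℕ) : ℕ := ∑ j, a j

/-- The weight vector of a monomial, zero-based: `wt a i = ω_{i+1}(x) = Σ_j α_i(a_j)`. -/
def wt {n : ℕ} (a : Fin n →₀ ℕ) (i : ℕ) : ℕ := ∑ j, a j / 2 ^ i % 2

/-- Left-lexicographic strict order on weight vectors. -/
def lexLt (w w' : ℕ → ℕ) : Prop := ∃ i, (∀ j, j < i → w j = w' j) ∧ w i < w' i

def lexLe (w w' : ℕ → ℕ) : Prop := w = w' ∨ lexLt w w'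

/-- `P_n^-(ω)`: span of monomials of degree `D = deg ω` with weight vector `< ω`. -/
def PnLt (n D : ℕ) (w : ℕ → ℕ) : Submodule (ZMod 2) (P n) :=
  Submodule.span (ZMod 2)
    {p | ∃ a : Fin n →₀ ℕ, mdeg a = D ∧ lexLt (wt a) w ∧ p = monomial a 1}

/-- `P_n(ω)`: span of monomials of degree `D = deg ω` with weight vector `≤ ω`. -/
def PnLe (n D : ℕ) (w : ℕ → ℕ) : Submodule (ZMod 2) (P n) :=
  Submodule.span (ZMod 2)
    {p | ∃ a : Fin n →₀ ℕ, mdeg a = D ∧ lexLe (wt a) w ∧ p = monomial a 1}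

/-- The order on monomials (of a common degree): first by weight vector, then by
exponent vector, both left-lexicographically. -/
def monLt {n : ℕ} (a b : Fin n →₀ ℕ) : Prop :=
  lexLt (wt a) (wt b) ∨
    (wt a = wt b ∧ ∃ j : Fin n, (∀ k, k < j → a k = b k) ∧ a j < b j)

/-- A monomial is inadmissible if it is congruent, modulo hit elements, to a sum of
strictly smaller monomials of the same degree. -/
def Inadmissible {n : ℕ} (a : Fin n →₀ ℕ) : Prop :=
  ∃ S : Finset (Fin n →₀ ℕ), (∀ b ∈ S, mdeg b = mdeg a ∧ monLt b a) ∧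
    ((monomial a 1 : P n) + ∑ b ∈ S, monomial b 1) ∈ hitS n

def Admissible {n : ℕ} (a : Fin n →₀ ℕ) : Prop := ¬ Inadmissible a

/-- Strict inadmissibility: with `s` the top of the weight vector, the monomial is
congruent to a sum of smaller monomials modulo `A_s^+ P_n`. -/
def StrictlyInadmissible {n : ℕ} (a : Fin n →₀ ℕ) : Prop :=
  ∃ s : ℕ, 1 ≤ s ∧ wt a (s - 1) ≠ 0 ∧ (∀ i, s ≤ i → wt a i = 0) ∧
    ∃ S : Finset (Fin n →₀ ℕ), (∀ b ∈ S, mdeg b = mdeg a ∧ monLt b a) ∧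
      ((monomial a 1 : P n) + ∑ b ∈ S, monomial b 1) ∈ AplusS n s

/-- Exponent vector from a tuple of exponents. -/
def ev {n : ℕ} (v : Fin n → ℕ) : Fin n →₀ ℕ := Finsupp.equivFunOnFinite.symm v

/-- `ν_k(x)`, the exponent of the (1-based) variable `x_k` in a monomial. -/
def nuE {m : ℕ} (b : Fin m →₀ ℕ) (k : ℕ) : ℕ := if h : k - 1 < m then b ⟨k - 1, h⟩ else 0

/-- `u`-compatibility of a monomial of `P_{n-1}` with a pair `(i; I)` (only `I` matters);
by convention every monomial is `1`-compatible with `(i; ∅)`. -/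
def uCompat {m : ℕ} (I : List ℕ) (u : ℕ) (b : Fin m →₀ ℕ) : Prop :=
  if I = [] then u = 1 else
    1 ≤ u ∧ u ≤ I.length ∧
    (∀ t, 1 ≤ t → t < u → nuE b (I.getD (t - 1) 0 - 1) = 2 ^ I.length - 1) ∧
    2 ^ I.length - 1 < nuE b (I.getD (u - 1) 0 - 1) ∧
    (∀ t, 1 ≤ t → t ≤ u → Nat.testBit (nuE b (I.getD (u - 1) 0 - 1)) (I.length - t) = true) ∧
    (∀ t, u < t → t ≤ I.length → Nat.testBit (nuE b (I.getD (t - 1) 0 - 1)) (I.length - t) = true)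

/-- The exponent vector of `x_{(I,u)} = x_{i_u}^{2^{r-1}+⋯+2^{r-u}} Π_{u<t≤r} x_{i_t}^{2^{r-t}}`. -/
def xIuExp (n : ℕ) (I : List ℕ) (u : ℕ) : Fin n → ℕ := fun k =>
  (if I.getD (u - 1) 0 = (k : ℕ) + 1 then 2 ^ I.length - 2 ^ (I.length - u) else 0) +
  ∑ t ∈ Finset.Icc (u + 1) I.length,
    if I.getD (t - 1) 0 = (k : ℕ) + 1 then 2 ^ (I.length - t) else 0

/-- The variable substitution underlying `f_i : P_{n-1} → P_n` (`x_j ↦ x_j` for `j < i`,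
`x_j ↦ x_{j+1}` for `j ≥ i`, in 1-based labels). -/
def fIdx (n i : ℕ) (j : Fin (n - 1)) : Fin n :=
  if (j : ℕ) + 1 < i then ⟨j, by have := j.isLt; omega⟩
  else ⟨(j : ℕ) + 1, by have := j.isLt; omega⟩

open Classical in
/-- `φ_{(i;I)}` evaluated on the monomial of `P_{n-1}` with exponent vector `b`:
`(x_i^{2^r - 1} f_i(x)) / x_{(I,u)}` if `x` is `u`-compatible with `(i;I)` for some `u`,
and `0` otherwise.  Here `i` and the entries of `I` are 1-based variable labels. -/
def phiMon (n i : ℕ) (I : List ℕ) (b : Fin (n - 1) →₀ ℕ) : P n :=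
  if h : ∃ u, uCompat I u b then
    monomial (ev fun k : Fin n =>
      (if (k : ℕ) + 1 = i then 2 ^ I.length - 1 else 0) +
        Finsupp.mapDomain (fIdx n i) b k - xIuExp n I (Classical.choose h) k) 1
  else 0

/-- Exponent vector of `X^e = (x_1 ⋯ x_m)^e` in `P_m`. -/
def Xexp (m e : ℕ) : Fin m →₀ ℕ := ev fun _ => e

/-- `X_u^e = (Π_{j ≠ u} x_j)^e` in `P_n` (`u` 1-based). -/
def XjMon (n u e : ℕ) : P n := monomial (ev fun k : Fin n => if (k : ℕ) + 1 = u then 0 else e) 1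

/-- `x_u^e` in `P_n` (`u` 1-based). -/
def xvMon (n u e : ℕ) : P n := monomial (ev fun k : Fin n => if (k : ℕ) + 1 = u then e else 0) 1

/-- The weight vector `((n-1)^{(d)}, 1)` (zero-based indexing). -/
def wSpike (n d : ℕ) : ℕ → ℕ := fun i => if i < d then n - 1 else if i = d then 1 else 0

/-- Kameko's map `ψ : P_5 → P_5`, `x_1x_2x_3x_4x_5 · y^2 ↦ y` on monomials, `0` otherwise. -/
def psi : P 5 →ₗ[ZMod 2] P 5 :=
  (basisMonomials (Fin 5) (ZMod 2)).constr (ZMod 2) fun a =>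
    if ∀ j, Odd (a j) then monomial (Finsupp.mapRange (· / 2) (Nat.zero_div 2) a) 1 else 0

/-- The Σ₅-invariant subspace of a subspace `V` of `QP_5 = P_5 / A^+P_5`: classes in `V`
having a representative `f` with `[σ · f] = [f]` for all permutations `σ` of the variables. -/
def invSub (V : Submodule (ZMod 2) (P 5 ⧸ hitS 5)) : Submodule (ZMod 2) (P 5 ⧸ hitS 5) where
  carrier := {q | q ∈ V ∧ ∃ f : P 5, (hitS 5).mkQ f = q ∧
      ∀ σ : Equiv.Perm (Fin 5), (hitS 5).mkQ (rename (⇑σ) f) = q}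
  add_mem' := by
    rintro a b ⟨haV, f, hf, hfa⟩ ⟨hbV, g, hg, hgb⟩
    refine ⟨V.add_mem haV hbV, f + g, ?_, fun σ => ?_⟩
    · simp [map_add, hf, hg]
    · simp [map_add, hfa σ, hgb σ]
  zero_mem' := ⟨V.zero_mem, 0, by simp, fun σ => by simp⟩
  smul_mem' := by
    rintro c a ⟨haV, f, hf, hfa⟩
    refine ⟨V.smul_mem c haV, c • f, ?_, fun σ => ?_⟩
    · simp [map_smul, hf]
    · simp [map_smul, hfa σ]

/-- The maps `ρ_1, …, ρ_5` generating the action of `GL_5` on `P_5`: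
`ρ_i` (for `1 ≤ i ≤ 4`) swaps `x_i, x_{i+1}`; `ρ_5` sends `x_1 ↦ x_1 + x_2`. -/
def rho5 (i : ℕ) : P 5 → P 5 := fun f =>
  if i = 1 then rename (⇑(Equiv.swap (0 : Fin 5) 1)) f
  else if i = 2 then rename (⇑(Equiv.swap (1 : Fin 5) 2)) f
  else if i = 3 then rename (⇑(Equiv.swap (2 : Fin 5) 3)) f
  else if i = 4 then rename (⇑(Equiv.swap (3 : Fin 5) 4)) f
  else if i = 5 then MvPolynomial.aeval (R := ZMod 2)
    (fun j : Fin 5 => if j = 0 then X 0 + X 1 else X j) f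
  else f

/-- The action of an invertible matrix on `P_5` by linear substitution of the variables. -/
def glAct (g : Matrix (Fin 5) (Fin 5) (ZMod 2)) (f : P 5) : P 5 :=
  MvPolynomial.aeval (R := ZMod 2) (fun i : Fin 5 => ∑ j : Fin 5, g i j • X j) f

/-- The weight vector `(3,3,4)` (zero-based indexing). -/
def w334 : ℕ → ℕ := fun i => if i = 0 then 3 else if i = 1 then 3 else if i = 2 then 4 else 0

/-- The weight vector `(3,3,2,1)` (zero-based indexing). -/
def w3321 : ℕ → ℕ := fun i =>
  if i = 0 then 3 else if i = 1 then 3 else if i = 2 then 2 else if i = 3 then 1 else 0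


def mon {n : ℕ} (a : Fin n → ℕ) : P n := monomial (ev a) 1

def DD (n d : ℕ) : ℕ := (n - 1) * (2 ^ d - 1) + 2 ^ d

theorem DD_succ (n d : ℕ) : DD n (d + 1) = (n - 1) + 2 * DD n d := by
  unfold DD
  obtain ⟨q, hq⟩ : ∃ q, 2 ^ d = q + 1 := ⟨2 ^ d - 1, by have := Nat.one_le_two_pow (n := d); omega⟩
  rw [pow_succ, hq]
  have : (q + 1) * 2 - 1 = 2 * q + 1 := by omega
  rw [this]
  simp only [Nat.add_sub_cancel]
  ring

def xx {n : ℕ} (j : Fin n) : Fin n → ℕ := fun k => if k = j then 0 else 1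

def Phi {n : ℕ} (j : Fin n) (f : P n) : P n := mon (xx j) * f ^ 2

def HSgen (n s d : ℕ) : Set (P n) :=
  {g | ∃ j h k, 1 ≤ j ∧ j < 2 ^ s ∧ h.IsHomogeneous k ∧ k + j = DD n d ∧
      g = homogeneousComponent (DD n d) (sqTot n h)} ∪
  {p | ∃ a : Fin n →₀ ℕ, mdeg a = DD n d ∧ lexLt (wt a) (wSpike n d) ∧ p = monomial a 1}

def HS (n s d : ℕ) : Submodule (ZMod 2) (P n) := Submodule.span (ZMod 2) (HSgen n s d)

@[simp] theorem ev_apply {n : ℕ} (v : Fin n → ℕ) (k : Fin n) : ev v k = v k := rfl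

theorem mon_mul {n : ℕ} (a b : Fin n → ℕ) : mon a * mon b = mon (a + b) := by
  unfold mon
  rw [monomial_mul, one_mul]
  have : ev a + ev b = ev (a + b) := by ext k; simp
  rw [this]

theorem mon_sq {n : ℕ} (a : Fin n → ℕ) : mon a ^ 2 = mon (fun k => 2 * a k) := by
  rw [sq, mon_mul]; congr 1; funext k; simp [two_mul]

theorem degree_eq_mdeg {n : ℕ} (a : Fin n →₀ ℕ) : a.degree = mdeg a := by
  rw [Finsupp.degree_eq_sum]; rfl

theorem hc_monomial {n : ℕ} (a : Fin n →₀ ℕ) (c : ZMod 2) (D : ℕ) :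
    homogeneousComponent D (monomial a c : P n) = if D = mdeg a then monomial a c else 0 := by
  rw [homogeneousComponent_of_mem (isHomogeneous_monomial c (degree_eq_mdeg a))]

theorem Psum_self {n : ℕ} (f : P n) : f + f = 0 := CharTwo.add_self_eq_zero f

theorem Psq_add {n : ℕ} (f g : P n) : (f + g) ^ 2 = f ^ 2 + g ^ 2 := CharTwo.add_sq f g

theorem Phi_add {n : ℕ} (j : Fin n) (f g : P n) : Phi j (f + g) = Phi j f + Phi j g := by
  unfold Phi; rw [Psq_add, mul_add]

theorem Phi_zero {n : ℕ} (j : Fin n) : Phi j (0 : P n) = 0 := by simp [Phi]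

theorem zmod2_sq (c : ZMod 2) : c * c = c := by revert c; decide

theorem mul_sq_monomial {n : ℕ} (b u : Fin n →₀ ℕ) (c : ZMod 2) :
    (monomial b 1 : P n) * (monomial u c) ^ 2 = c • monomial (b + (u + u)) 1 := by
  rw [sq, monomial_mul, monomial_mul, zmod2_sq, smul_monomial, one_mul]
  simp

theorem Phi_smul {n : ℕ} (j : Fin n) (c : ZMod 2) (f : P n) : Phi j (c • f) = c • Phi j f := by
  unfold Phi
  rw [smul_pow, sq c, zmod2_sq, mul_smul_comm]

theorem mdeg_add {n : ℕ} (a b : Fin n →₀ ℕ) : mdeg (a + b) = mdeg a + mdeg b := by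
  simp [mdeg, Finset.sum_add_distrib]

theorem mdeg_xx {n : ℕ} (j : Fin n) : mdeg (ev (xx j)) = n - 1 := by
  simp only [mdeg, ev_apply, xx]
  rw [Finset.sum_ite, Finset.sum_const_zero, zero_add, Finset.sum_const, smul_eq_mul, mul_one]
  rw [Finset.filter_ne' , Finset.card_erase_of_mem (Finset.mem_univ _)]; simp

theorem hc_Phi {n : ℕ} (j : Fin n) (d : ℕ) (G : P n) :
    homogeneousComponent (DD n (d + 1)) (Phi j G) = Phi j (homogeneousComponent (DD n d) G) := by
  induction G using MvPolynomial.induction_on' with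
  | monomial u c =>
    rw [hc_monomial]
    unfold Phi mon
    rw [mul_sq_monomial, map_smul, hc_monomial, mdeg_add, mdeg_add, mdeg_xx, DD_succ]
    by_cases h : DD n d = mdeg u
    · rw [if_pos h, if_pos (by omega), mul_sq_monomial]
    · rw [if_neg h, if_neg (by omega)]; simp
  | add p q hp hq => rw [Phi_add, map_add, map_add, Phi_add, hp, hq]

theorem low_mem {n s d : ℕ} (a : Fin n →₀ ℕ) (h1 : mdeg a = DD n d)
    (h2 : lexLt (wt a) (wSpike n d)) : (monomial a 1 : P n) ∈ HS n s d :=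
  Submodule.subset_span (Or.inr ⟨a, h1, h2, rfl⟩)

theorem HS_mono {n s t d : ℕ} (h : s ≤ t) : HS n s d ≤ HS n t d := by
  apply Submodule.span_mono
  rintro g (⟨j, f, k, h1, h2, h3⟩ | h')
  · exact Or.inl ⟨j, f, k, h1, h2.trans_le (Nat.pow_le_pow_right (by norm_num) h), h3⟩
  · exact Or.inr h'

theorem SqK_hom {n j k : ℕ} (h : P n) (hh : h.IsHomogeneous k) :
    homogeneousComponent (k + j) (sqTot n h) = SqK n j h := by
  unfold SqK
  by_cases h0 : h = 0
  · subst h0; simp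
  rw [hh.totalDegree h0, Finset.sum_eq_single k]
  · rw [homogeneousComponent_eq_self hh]
  · intro b _ hb
    rw [homogeneousComponent_of_mem hh, if_neg hb]; simp
  · simp

theorem HS_le (n s d : ℕ) : HS n s d ≤ AplusS n s ⊔ PnLt n (DD n d) (wSpike n d) := by
  unfold HS
  rw [Submodule.span_le]
  rintro g (⟨j, h, k, h1, h2, h3, h4, rfl⟩ | h')
  · apply Submodule.mem_sup_left
    apply Submodule.subset_span
    exact ⟨j, h1, h2, h, by rw [← h4, SqK_hom h h3]⟩
  · exact Submodule.mem_sup_right (Submodule.subset_span h')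

theorem wt_le {n : ℕ} (a : Fin n →₀ ℕ) (i : ℕ) (w : Fin n) (h : a w / 2 ^ i % 2 = 0) :
    wt a i ≤ n - 1 := by
  unfold wt
  calc _ ≤ ∑ k, xx w k := by
        apply Finset.sum_le_sum
        intro k _
        unfold xx
        split_ifs with hk
        · subst hk; omega
        · omega
    _ = n - 1 := by have := mdeg_xx w; simpa [mdeg] using this

theorem wt_lt {n : ℕ} (a : Fin n →₀ ℕ) (i : ℕ) (w v : Fin n) (hwv : w ≠ v)
    (h : a w / 2 ^ i % 2 = 0) (h' : a v / 2 ^ i % 2 = 0) :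
    wt a i < n - 1 := by
  unfold wt
  calc _ < ∑ k, xx w k := by
        apply Finset.sum_lt_sum
        · intro k _
          unfold xx
          split_ifs with hk
          · subst hk; omega
          · omega
        · exact ⟨v, Finset.mem_univ _, by rw [h']; simp [xx, hwv.symm]⟩
    _ = n - 1 := by have := mdeg_xx w; simpa [mdeg] using this

theorem low_crit {n d : ℕ} (a : Fin n →₀ ℕ) (i : ℕ) (hi : i < d)
    (h : ∀ j < i, wt a j ≤ n - 1) (h' : wt a i < n - 1) : lexLt (wt a) (wSpike n d) := by
  classical
  have hex : ∃ i, wt a i < n - 1 := ⟨i, h'⟩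
  have hle : Nat.find hex ≤ i := Nat.find_min' hex h'
  refine ⟨Nat.find hex, fun j hj => ?_, ?_⟩
  · have h1 := Nat.find_min hex hj
    have h2 := h j (by omega)
    simp only [wSpike]; rw [if_pos (by omega)]; omega
  · have := Nat.find_spec hex
    simp only [wSpike]; rw [if_pos (by omega)]; exact this

def L0 (n : ℕ) : Submodule (ZMod 2) (P n) :=
  Submodule.span (ZMod 2) {p | ∃ a : Fin n →₀ ℕ, wt a 0 < n - 1 ∧ p = monomial a 1}

theorem hc_L0 {n s d : ℕ} (hd : 1 ≤ d) (p : P n) (hp : p ∈ L0 n) :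
    homogeneousComponent (DD n d) p ∈ HS n s d := by
  unfold L0 at hp
  induction hp using Submodule.span_induction with
  | mem x hx =>
    obtain ⟨a, ha, rfl⟩ := hx
    rw [hc_monomial]
    split_ifs with h
    · exact low_mem a h.symm (low_crit a 0 (by omega) (by simp) ha)
    · exact zero_mem _
  | zero => simp
  | add x y _ _ hx hy => rw [map_add]; exact add_mem hx hy
  | smul c x _ hx => rw [map_smul]; exact Submodule.smul_mem _ _ hx

theorem L0_mul_sq {n : ℕ} (b : Fin n →₀ ℕ) (hb : wt b 0 < n - 1) (G : P n) :
    (monomial b 1 : P n) * G ^ 2 ∈ L0 n := by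
  induction G using MvPolynomial.induction_on' with
  | monomial u c =>
    rw [mul_sq_monomial]
    apply Submodule.smul_mem
    apply Submodule.subset_span
    refine ⟨_, ?_, rfl⟩
    convert hb using 1
    unfold wt
    apply Finset.sum_congr rfl
    intro k _
    simp only [Finsupp.add_apply, pow_zero, Nat.div_one]
    omega
  | add p q hp hq => rw [Psq_add, mul_add]; exact add_mem hp hq

theorem mon_eq_prod {n : ℕ} (a : Fin n → ℕ) : mon a = ∏ i, (X i : P n) ^ a i := by
  unfold mon
  rw [monomial_eq, Finsupp.prod_fintype _ _ (by simp)]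
  simp

theorem sqTot_mon {n : ℕ} (a : Fin n → ℕ) :
    sqTot n (mon a) = mon a * ∏ i, (1 + X i) ^ a i := by
  rw [mon_eq_prod, map_prod, ← Finset.prod_mul_distrib]
  apply Finset.prod_congr rfl
  intro i _
  rw [map_pow, sqTot, bind₁_X_right, ← mul_pow]
  congr 1; ring

theorem sqTot_xx {n : ℕ} (j : Fin n) :
    sqTot n (mon (xx j)) = mon (xx j) * ∑ t ∈ (Finset.univ.erase j).powerset, ∏ i ∈ t, (X i : P n) := by
  rw [sqTot_mon, ← Finset.prod_one_add, ← Finset.prod_erase_mul _ _ (Finset.mem_univ j)]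
  congr 1
  simp only [xx, if_true, pow_zero, mul_one]
  apply Finset.prod_congr rfl
  intro i hi
  rw [if_neg (Finset.ne_of_mem_erase hi), pow_one]

theorem prodX_eq {n : ℕ} (t : Finset (Fin n)) :
    ∏ i ∈ t, (X i : P n) = mon (fun k => if k ∈ t then 1 else 0) := by
  rw [mon_eq_prod]
  simp [pow_ite, Finset.prod_ite_mem]

theorem Phi_gen {n s d : ℕ} (u : Fin n) (j k : ℕ) (h : P n) (h1 : 1 ≤ j) (h2 : j < 2 ^ s)
    (h3 : h.IsHomogeneous k) (h4 : k + j = DD n d) :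
    Phi u (homogeneousComponent (DD n d) (sqTot n h)) ∈ HS n (s + 1) (d + 1) := by
  have key : sqTot n (Phi u h) = Phi u (sqTot n h) +
      ∑ t ∈ (Finset.univ.erase u).powerset.erase ∅, (mon (xx u) * ∏ i ∈ t, (X i : P n)) * (sqTot n h) ^ 2 := by
    unfold Phi
    rw [map_mul, map_pow, sqTot_xx, ← Finset.add_sum_erase _ _ (Finset.empty_mem_powerset _),
      mul_add, add_mul, Finset.prod_empty, mul_one, Finset.mul_sum, Finset.sum_mul]
  have hlow : homogeneousComponent (DD n (d + 1)) (∑ t ∈ (Finset.univ.erase u).powerset.erase ∅,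
      (mon (xx u) * ∏ i ∈ t, (X i : P n)) * (sqTot n h) ^ 2) ∈ HS n (s + 1) (d + 1) := by
    apply hc_L0 (by omega)
    apply Submodule.sum_mem
    intro t ht
    rw [prodX_eq, mon_mul]
    apply L0_mul_sq
    obtain ⟨w, hw⟩ := Finset.nonempty_iff_ne_empty.mpr (Finset.ne_of_mem_erase ht)
    have hsub := Finset.mem_powerset.mp (Finset.mem_of_mem_erase ht)
    have hwu : w ≠ u := Finset.ne_of_mem_erase (hsub hw)
    have hut : u ∉ t := fun h => Finset.notMem_erase _ _ (hsub h)
    apply wt_lt _ _ w u hwu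
    · simp [xx, hwu, hw]
    · simp [xx, hut]
  have hgen : homogeneousComponent (DD n (d + 1)) (sqTot n (Phi u h)) ∈ HS n (s + 1) (d + 1) := by
    apply Submodule.subset_span
    refine Or.inl ⟨2 * j, Phi u h, (n - 1) + 2 * k, by omega, by rw [pow_succ]; omega, ?_, ?_, rfl⟩
    · unfold Phi
      apply IsHomogeneous.mul
      · exact isHomogeneous_monomial _ (by rw [degree_eq_mdeg, mdeg_xx])
      · rw [mul_comm]; exact h3.pow 2
    · rw [DD_succ]; omega
  rw [key, map_add, hc_Phi] at hgen
  exact (Submodule.add_mem_iff_left _ hlow).mp hgen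

theorem wt_Phi {n : ℕ} (u : Fin n) (a : Fin n →₀ ℕ) (i : ℕ) :
    wt (ev (xx u) + (a + a)) i = if i = 0 then n - 1 else wt a (i - 1) := by
  unfold wt
  split_ifs with h
  · subst h
    rw [← mdeg_xx u, mdeg]
    apply Finset.sum_congr rfl
    intro k _
    simp only [Finsupp.add_apply, ev_apply, pow_zero, Nat.div_one, xx]
    split_ifs <;> omega
  · obtain ⟨i, rfl⟩ := Nat.exists_eq_succ_of_ne_zero h
    apply Finset.sum_congr rfl
    intro k _
    simp only [Finsupp.add_apply, ev_apply, Nat.succ_eq_add_one, Nat.add_sub_cancel]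
    rw [pow_succ', ← Nat.div_div_eq_div_mul]
    congr 2
    unfold xx
    split_ifs <;> omega

theorem Phi_mem {n s d : ℕ} (u : Fin n) (f : P n) (hf : f ∈ HS n s d) :
    Phi u f ∈ HS n (s + 1) (d + 1) := by
  unfold HS at hf
  induction hf using Submodule.span_induction with
  | mem x hx =>
    obtain ⟨j, h, k, h1, h2, h3, h4, rfl⟩ | ⟨a, h1, ⟨i, h2, h3⟩, rfl⟩ := hx
    · exact Phi_gen u j k h h1 h2 h3 h4
    · unfold Phi mon
      rw [mul_sq_monomial, one_smul]
      apply low_mem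
      · rw [mdeg_add, mdeg_add, mdeg_xx, DD_succ]; omega
      · have hw : ∀ i, wSpike n (d + 1) i = if i = 0 then n - 1 else wSpike n d (i - 1) := by
          intro i
          rcases i with _ | i
          · simp [wSpike]
          · simp [wSpike]
        refine ⟨i + 1, fun j hj => ?_, ?_⟩
        · rw [wt_Phi, hw]
          rcases j with _ | j
          · simp
          · simpa using h2 j (by omega)
        · rw [wt_Phi, hw]; simpa using h3
  | zero => rw [Phi_zero]; exact zero_mem _
  | add x y _ _ hx hy => rw [Phi_add]; exact add_mem hx hy
  | smul c x _ hx => rw [Phi_smul]; exact Submodule.smul_mem _ _ hx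

theorem prod_sub_mem {n : ℕ} (a : Fin n → ℕ) (ha : ∀ k, a k % 2 = 1) :
    (∏ i, (1 + X i : P n) ^ a i) - (1 + ∑ i, X i) ∈ idealOfVars (Fin n) (ZMod 2) ^ 2 := by
  set I := idealOfVars (Fin n) (ZMod 2) ^ 2 with hI
  have hX : ∀ i j, Ideal.Quotient.mk I (X i) * Ideal.Quotient.mk I (X j) = 0 := by
    intro i j
    rw [← map_mul, Ideal.Quotient.eq_zero_iff_mem, hI, sq]
    exact Ideal.mul_mem_mul (Ideal.subset_span ⟨i, rfl⟩) (Ideal.subset_span ⟨j, rfl⟩)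
  have h2 : (2 : P n ⧸ I) = 0 := by
    have : (2 : P n) = 0 := CharTwo.two_eq_zero
    rw [← map_ofNat (Ideal.Quotient.mk I) 2, this, map_zero]
  rw [← Ideal.Quotient.eq_zero_iff_mem, map_sub, sub_eq_zero, map_prod, map_add, map_one, map_sum]
  have h1 : ∀ i, Ideal.Quotient.mk I ((1 + X i) ^ a i) = 1 + Ideal.Quotient.mk I (X i) := by
    intro i
    obtain ⟨b, hb⟩ : ∃ b, a i = 2 * b + 1 := ⟨a i / 2, by have := ha i; omega⟩
    rw [hb, map_pow, map_add, map_one, pow_succ, pow_mul]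
    have : (1 + Ideal.Quotient.mk I (X i)) ^ 2 = 1 := by
      linear_combination hX i i + Ideal.Quotient.mk I (X i) * h2
    rw [this, one_pow, one_mul]
  rw [Finset.prod_congr rfl (fun i _ => h1 i)]
  suffices ∀ s : Finset (Fin n), ∏ i ∈ s, (1 + Ideal.Quotient.mk I (X i)) =
      1 + ∑ i ∈ s, Ideal.Quotient.mk I (X i) from this _
  intro s
  induction s using Finset.induction_on with
  | empty => simp
  | insert i s hi ih =>
    rw [Finset.prod_insert hi, Finset.sum_insert hi, ih, add_mul, one_mul, mul_add, mul_one,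
      Finset.mul_sum]
    rw [Finset.sum_congr rfl (fun j _ => hX i j)]
    simp only [Finset.sum_const_zero]; ring

theorem sq1_mem {n d : ℕ} (a : Fin n → ℕ) (ha : ∀ k, a k % 2 = 1)
    (hdeg : ∑ k, a k + 1 = DD n d) :
    ∑ w, mon (a + Pi.single w 1) ∈ HS n 1 d := by
  have hgen : homogeneousComponent (DD n d) (sqTot n (mon a)) ∈ HS n 1 d :=
    Submodule.subset_span (Or.inl ⟨1, mon a, ∑ k, a k, le_rfl, by norm_num,
      isHomogeneous_monomial _ (by rw [degree_eq_mdeg]; rfl), hdeg, rfl⟩)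
  convert hgen using 1
  obtain ⟨r, hr, hr'⟩ : ∃ r, r ∈ idealOfVars (Fin n) (ZMod 2) ^ 2 ∧
      (∏ i, (1 + X i : P n) ^ a i) = (1 + ∑ i, X i) + r :=
    ⟨_, prod_sub_mem a ha, by ring⟩
  have hmr : homogeneousComponent (DD n d) (mon a * r) = 0 := by
    have : mon a * r ∈ idealOfVars (Fin n) (ZMod 2) ^ (∑ k, a k + 2) := by
      rw [pow_add]
      refine Ideal.mul_mem_mul ?_ hr
      rw [mon, monomial_mem_pow_idealOfVars_iff _ _ one_ne_zero, degree_eq_mdeg]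
      exact le_rfl
    apply homogeneousComponent_eq_zero'
    intro x hx
    have := (mem_pow_idealOfVars_iff _ _).mp this x hx
    omega
  rw [sqTot_mon, hr', mul_add, map_add, hmr, add_zero, mul_add, mul_one, map_add, Finset.mul_sum,
    map_sum]
  have h1 : homogeneousComponent (DD n d) (mon a) = 0 := by
    rw [mon, hc_monomial, if_neg]
    have : mdeg (ev a) = ∑ k, a k := rfl
    omega
  rw [h1, zero_add]
  apply Finset.sum_congr rfl
  intro w _
  have : (X w : P n) = mon (Pi.single w 1) := by
    have h2 : ev (Pi.single w 1) = Finsupp.single w 1 := by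
      ext k
      simp [Finsupp.single_apply, Pi.single_apply, eq_comm]
    rw [mon, h2]; rfl
  rw [this, mon_mul, mon, hc_monomial, if_pos]
  rw [← hdeg]
  simp only [mdeg, ev_apply, Pi.add_apply, Finset.sum_add_distrib]
  simp

theorem DD_add (n c e : ℕ) : DD n (c + e) + (2 ^ e - 1) = (n - 1) * (2 ^ e - 1) + (2 ^ e - 1) + 2 ^ e * DD n c := by
  induction e with
  | zero => simp
  | succ e ih =>
    rw [← Nat.add_assoc, DD_succ]
    have h1 : 2 ^ (e + 1) - 1 = 2 * (2 ^ e - 1) + 1 := by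
      have := Nat.one_le_two_pow (n := e); rw [pow_succ]; omega
    rw [h1, pow_succ]
    generalize 2 ^ e - 1 = q at *
    generalize 2 ^ e = r at *
    nlinarith

def mm {n : ℕ} (e : ℕ) (u v : Fin n) (p : ℕ) (z : Fin n → ℕ) : Fin n → ℕ := fun k =>
  if k = u then p + 2 ^ (e + 1) * z k else
  if k = v then (2 ^ (e + 1) - 1 - p) + 2 ^ (e + 1) * z k else (2 ^ (e + 1) - 1) + 2 ^ (e + 1) * z k

theorem mm_sum {n c : ℕ} (e : ℕ) (u v : Fin n) (huv : u ≠ v) (p : ℕ) (z : Fin n → ℕ)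
    (hz : ∑ k, z k = DD n c) (hp : p ≤ 2 ^ (e + 1) - 1) :
    ∑ k, mm e u v p z k = DD n (c + (e + 1)) := by
  have h1 : ∀ k, mm e u v p z k + ((if k = u then 2 ^ (e + 1) - 1 - p else 0) + (if k = v then p else 0))
      = (2 ^ (e + 1) - 1) + 2 ^ (e + 1) * z k := by
    intro k
    unfold mm
    by_cases hu : k = u
    · subst hu; simp [huv]; omega
    · by_cases hv : k = v
      · subst hv; simp [hu]; omega
      · simp [hu, hv]
  have h2 : ∑ k, (mm e u v p z k + ((if k = u then 2 ^ (e + 1) - 1 - p else 0) + (if k = v then p else 0)))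
      = ∑ k, ((2 ^ (e + 1) - 1) + 2 ^ (e + 1) * z k) := Finset.sum_congr rfl (fun k _ => h1 k)
  simp only [Finset.sum_add_distrib, Finset.sum_ite_eq', Finset.mem_univ, if_true, ← Finset.mul_sum,
    hz, Finset.sum_const, Finset.card_univ, Fintype.card_fin, smul_eq_mul] at h2
  have h3 := DD_add n c (e + 1)
  have hn : n = (n - 1) + 1 := by have := u.isLt; omega
  have h4 : n * (2 ^ (e + 1) - 1) = (n - 1) * (2 ^ (e + 1) - 1) + (2 ^ (e + 1) - 1) := by
    conv_lhs => rw [hn]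
    ring
  omega

theorem exists_bit (e p : ℕ) (hp : p + 1 < 2 ^ (e + 1)) : ∃ i ≤ e, p / 2 ^ i % 2 = 0 := by
  induction e generalizing p with
  | zero => exact ⟨0, le_rfl, by simp at hp; simp; omega⟩
  | succ e ih =>
    by_cases h : p % 2 = 0
    · exact ⟨0, by omega, by simpa using h⟩
    · obtain ⟨i, hi, h'⟩ := ih (p / 2) (by rw [pow_succ] at hp; omega)
      exact ⟨i + 1, by omega, by rw [pow_succ', ← Nat.div_div_eq_div_mul]; exact h'⟩

theorem bit_low (e i p z : ℕ) (hi : i ≤ e) : (p + 2 ^ (e + 1) * z) / 2 ^ i % 2 = p / 2 ^ i % 2 := by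
  obtain ⟨t, rfl⟩ := Nat.exists_eq_add_of_le hi
  have : p + 2 ^ (i + t + 1) * z = p + 2 ^ i * (2 * (2 ^ t * z)) := by ring
  rw [this, Nat.add_mul_div_left _ _ (by positivity)]
  omega

theorem low_one {n c : ℕ} (e : ℕ) (u w : Fin n) (huw : w ≠ u) (p : ℕ) (b : Fin n → ℕ) (zu zw : ℕ)
    (hu : b u = p + 2 ^ (e + 1) * zu) (hw : b w = 0 + 2 ^ (e + 1) * zw) (hp : p + 1 < 2 ^ (e + 1))
    (hb : ∑ k, b k = DD n (c + (e + 1))) : mon b ∈ HS n 1 (c + (e + 1)) := by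
  obtain ⟨i, hi, hbit⟩ := exists_bit e p hp
  have hwz : ∀ j ≤ e, (ev b) w / 2 ^ j % 2 = 0 := by
    intro j hj
    rw [ev_apply, hw, bit_low e j _ _ hj, Nat.zero_div]
  have huz : (ev b) u / 2 ^ i % 2 = 0 := by
    rw [ev_apply, hu, bit_low e i _ _ hi, hbit]
  refine low_mem _ hb (low_crit _ i (by omega) (fun j hj => ?_) ?_)
  · exact wt_le _ _ w (hwz j (by omega))
  · exact wt_lt _ _ w u huw (hwz i hi) huz

def aa {n : ℕ} (E : ℕ) (u v : Fin n) (p : ℕ) (z : Fin n → ℕ) : Fin n → ℕ := fun k =>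
  if k = u then p + E * z k else
  if k = v then (E - 2 - p) + E * z k else (E - 1) + E * z k

theorem aa_odd {n : ℕ} (q : ℕ) (u v : Fin n) (p : ℕ) (z : Fin n → ℕ) (hp1 : p % 2 = 1)
    (hp : p + 3 ≤ 2 * q) (k : Fin n) : aa (2 * q) u v p z k % 2 = 1 := by
  unfold aa
  rw [mul_assoc]
  split_ifs <;> omega

theorem aa_v {n : ℕ} (e : ℕ) (u v : Fin n) (huv : u ≠ v) (p : ℕ) (z : Fin n → ℕ)
    (hp : p + 3 ≤ 2 ^ (e + 1)) : aa (2 ^ (e + 1)) u v p z + Pi.single v 1 = mm e u v p z := by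
  funext k
  simp only [Pi.add_apply, Pi.single_apply, aa, mm]
  generalize 2 ^ (e + 1) = E at *
  generalize E * z k = F at *
  by_cases hu : k = u
  · subst hu; simp [huv]
  · by_cases hv : k = v
    · subst hv; simp [hu]; omega
    · simp [hu, hv]

theorem aa_u {n : ℕ} (e : ℕ) (u v : Fin n) (p : ℕ) (z : Fin n → ℕ)
    (hp : p + 3 ≤ 2 ^ (e + 1)) : aa (2 ^ (e + 1)) u v p z + Pi.single u 1 = mm e u v (p + 1) z := by
  funext k
  simp only [Pi.add_apply, Pi.single_apply, aa, mm]
  generalize 2 ^ (e + 1) = E at *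
  generalize E * z k = F at *
  by_cases hu : k = u
  · subst hu; simp; omega
  · by_cases hv : k = v
    · subst hv; simp [hu]; omega
    · simp [hu, hv]

theorem sum_single {n : ℕ} (a : Fin n → ℕ) (w : Fin n) :
    ∑ k, (a + Pi.single w 1 : Fin n → ℕ) k = ∑ k, a k + 1 := by
  simp [Finset.sum_add_distrib]

theorem sum_split {n : ℕ} {M : Type} [AddCommMonoid M] (u v : Fin n) (huv : u ≠ v) (F : Fin n → M) :
    ∑ w, F w = F v + F u + ∑ w ∈ (Finset.univ.erase v).erase u, F w := by
  rw [add_assoc, Finset.add_sum_erase _ _ (Finset.mem_erase.mpr ⟨huv, Finset.mem_univ u⟩),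
    Finset.add_sum_erase _ _ (Finset.mem_univ v)]

theorem S1 {n c : ℕ} (e : ℕ) (u v : Fin n) (huv : u ≠ v) (p : ℕ) (z : Fin n → ℕ)
    (hz : ∑ k, z k = DD n c) (hp1 : p % 2 = 1) (hp : p + 3 ≤ 2 ^ (e + 1)) :
    mon (mm e u v p z) + mon (mm e u v (p + 1) z) ∈ HS n 1 (c + (e + 1)) := by
  have hodd : ∀ k, aa (2 ^ (e + 1)) u v p z k % 2 = 1 := by
    intro k
    have hp' := hp
    rw [pow_succ'] at hp' ⊢
    exact aa_odd _ u v p z hp1 hp' k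
  have hav := aa_v e u v huv p z hp
  have hau := aa_u e u v p z hp
  have hwu : ∀ w, w ≠ u → w ≠ v →
      (aa (2 ^ (e + 1)) u v p z + Pi.single w 1 : Fin n → ℕ) u = p + 2 ^ (e + 1) * z u := by
    intro w hwu _
    rw [Pi.add_apply, Pi.single_apply, if_neg hwu.symm, add_zero]
    exact if_pos rfl
  have hww : ∀ w, w ≠ u → w ≠ v →
      (aa (2 ^ (e + 1)) u v p z + Pi.single w 1 : Fin n → ℕ) w = 0 + 2 ^ (e + 1) * (z w + 1) := by
    intro w hwu hwv
    rw [Pi.add_apply, Pi.single_eq_same, aa, if_neg hwu, if_neg hwv, mul_add]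
    generalize 2 ^ (e + 1) = E at *
    generalize E * z w = F at *
    omega
  generalize aa (2 ^ (e + 1)) u v p z = a at *
  have hsum : ∑ k, a k + 1 = DD n (c + (e + 1)) := by
    rw [← mm_sum e u v huv p z hz (by omega), ← hav, sum_single]
  have h := sq1_mem a hodd hsum
  have h' := sum_split u v huv (fun w => mon (a + Pi.single w 1))
  simp only [hav, hau] at h'
  rw [h'] at h
  refine (Submodule.add_mem_iff_left _ ?_).mp h
  apply Submodule.sum_mem
  intro w hw
  simp only [Finset.mem_erase, Finset.mem_univ, and_true] at hw
  exact low_one e u w hw.1 p _ (z u) (z w + 1) (hwu w hw.1 hw.2) (hww w hw.1 hw.2) (by omega)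
    ((sum_single a w).trans hsum)

theorem Phi_mon {n : ℕ} (j : Fin n) (a : Fin n → ℕ) :
    Phi j (mon a) = mon (fun k => (if k = j then 0 else 1) + 2 * a k) := by
  unfold Phi
  rw [mon_sq, mon_mul]
  rfl

theorem Phi_mm_v {n : ℕ} (e : ℕ) (u v : Fin n) (huv : u ≠ v) (p : ℕ) (z : Fin n → ℕ)
    (hp : p + 1 ≤ 2 ^ (e + 1)) : Phi v (mon (mm e u v p z)) = mon (mm (e + 1) u v (2 * p + 1) z) := by
  rw [Phi_mon]
  congr 1
  funext k
  unfold mm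
  rw [pow_succ _ (e + 1), mul_comm _ 2, mul_assoc]
  by_cases hu : k = u
  · subst hu; simp [huv]; omega
  · by_cases hv : k = v
    · subst hv; simp [hu]; omega
    · simp [hu, hv]; omega

theorem Phi_mm_u {n : ℕ} (e : ℕ) (u v : Fin n) (huv : u ≠ v) (p : ℕ) (z : Fin n → ℕ)
    (hp : p + 1 ≤ 2 ^ (e + 1)) : Phi u (mon (mm e u v p z)) = mon (mm (e + 1) u v (2 * p) z) := by
  rw [Phi_mon]
  congr 1
  funext k
  unfold mm
  rw [pow_succ _ (e + 1), mul_comm _ 2, mul_assoc]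
  by_cases hu : k = u
  · subst hu; simp; omega
  · by_cases hv : k = v
    · subst hv; simp [hu]; omega
    · simp [hu, hv]; omega

theorem HS_trans {n s d : ℕ} {f g h : P n} (h1 : f + g ∈ HS n s d) (h2 : g + h ∈ HS n s d) :
    f + h ∈ HS n s d := by
  have := add_mem h1 h2
  have h3 : f + g + (g + h) = f + h + (g + g) := by ring
  rwa [h3, Psum_self, add_zero] at this

theorem HS_symm {n s d : ℕ} {f g : P n} (h1 : f + g ∈ HS n s d) : g + f ∈ HS n s d := by
  rwa [add_comm]

theorem S4 {n c : ℕ} (e : ℕ) (u v : Fin n) (huv : u ≠ v) (z : Fin n → ℕ)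
    (hz : ∑ k, z k = DD n c) (he : 1 ≤ e) :
    mon (mm e u v 1 z) + mon (mm e u v (2 ^ (e + 1) - 2) z) ∈ HS n 2 (c + (e + 1)) := by
  obtain ⟨f, rfl⟩ : ∃ f, e = f + 1 := ⟨e - 1, by omega⟩
  have hS1 : ∀ p, p % 2 = 1 → p + 3 ≤ 2 ^ (f + 1 + 1) →
      mon (mm (f + 1) u v p z) + mon (mm (f + 1) u v (p + 1) z) ∈ HS n 2 (c + (f + 1 + 1)) :=
    fun p h1 h2 => HS_mono (by norm_num) (S1 (f + 1) u v huv p z hz h1 h2)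
  have hS2v : ∀ p, p % 2 = 1 → p + 3 ≤ 2 ^ (f + 1) →
      mon (mm (f + 1) u v (2 * p + 1) z) + mon (mm (f + 1) u v (2 * (p + 1) + 1) z)
        ∈ HS n 2 (c + (f + 1 + 1)) := by
    intro p h1 h2
    have := Phi_mem v _ (S1 f u v huv p z hz h1 h2)
    rwa [Phi_add, Phi_mm_v f u v huv _ z (by omega), Phi_mm_v f u v huv _ z (by omega)] at this
  have hS2u : ∀ p, p % 2 = 1 → p + 3 ≤ 2 ^ (f + 1) →
      mon (mm (f + 1) u v (2 * p) z) + mon (mm (f + 1) u v (2 * (p + 1)) z)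
        ∈ HS n 2 (c + (f + 1 + 1)) := by
    intro p h1 h2
    have := Phi_mem u _ (S1 f u v huv p z hz h1 h2)
    rwa [Phi_add, Phi_mm_u f u v huv _ z (by omega), Phi_mm_u f u v huv _ z (by omega)] at this
  have hpow : 2 ^ (f + 1 + 1) = 4 * 2 ^ f := by ring
  have hpow' : 2 ^ (f + 1) = 2 * 2 ^ f := by ring
  have key : ∀ k, 4 * k + 4 ≤ 4 * 2 ^ f →
      mon (mm (f + 1) u v 1 z) + mon (mm (f + 1) u v (4 * k + 1) z) ∈ HS n 2 (c + (f + 1 + 1)) := by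
    intro k
    induction k with
    | zero => intro _; rw [Psum_self]; exact zero_mem _
    | succ k ih =>
      intro hk
      have a1 := hS1 (4 * k + 1) (by omega) (by omega)
      have a2 := hS2u (2 * k + 1) (by omega) (by omega)
      have a3 := hS1 (4 * k + 3) (by omega) (by omega)
      have a4 := hS2v (2 * k + 1) (by omega) (by omega)
      rw [show 2 * (2 * k + 1) = 4 * k + 1 + 1 by ring,
        show 2 * (2 * k + 1 + 1) = 4 * k + 3 + 1 by ring] at a2
      rw [show 2 * (2 * k + 1) + 1 = 4 * k + 3 by ring,
        show 2 * (2 * k + 1 + 1) + 1 = 4 * (k + 1) + 1 by ring] at a4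
      exact HS_trans (HS_trans (HS_trans (HS_trans (ih (by omega)) a1) a2) (HS_symm a3)) a4
  have h1 := Nat.one_le_two_pow (n := f)
  have k1 := key (2 ^ f - 1) (by omega)
  have k2 := hS1 (4 * (2 ^ f - 1) + 1) (by omega) (by omega)
  rw [show 4 * (2 ^ f - 1) + 1 + 1 = 2 ^ (f + 1 + 1) - 2 by omega] at k2
  exact HS_trans k1 k2

def PhiL {n : ℕ} (l : List (Fin n)) (f : P n) : P n := l.foldr Phi f

theorem PhiL_nil {n : ℕ} (f : P n) : PhiL [] f = f := rfl
theorem PhiL_cons {n : ℕ} (j : Fin n) (l : List (Fin n)) (f : P n) :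
    PhiL (j :: l) f = Phi j (PhiL l f) := rfl
theorem PhiL_append {n : ℕ} (l l' : List (Fin n)) (f : P n) :
    PhiL (l ++ l') f = PhiL l (PhiL l' f) := by simp [PhiL]

theorem PhiL_add {n : ℕ} (l : List (Fin n)) (f g : P n) :
    PhiL l (f + g) = PhiL l f + PhiL l g := by
  induction l with
  | nil => rfl
  | cons j l ih => rw [PhiL_cons, PhiL_cons, PhiL_cons, ih, Phi_add]

theorem PhiL_zero {n : ℕ} (l : List (Fin n)) : PhiL l (0 : P n) = 0 := by
  induction l with
  | nil => rfl
  | cons j l ih => rw [PhiL_cons, ih, Phi_zero]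

theorem PhiL_sum {n : ℕ} {ι : Type} (l : List (Fin n)) (s : Finset ι) (f : ι → P n) :
    PhiL l (∑ i ∈ s, f i) = ∑ i ∈ s, PhiL l (f i) := by
  classical
  induction s using Finset.induction_on with
  | empty => simp [PhiL_zero]
  | insert i s hi ih => rw [Finset.sum_insert hi, Finset.sum_insert hi, PhiL_add, ih]

theorem PhiL_mem {n s d : ℕ} (l : List (Fin n)) (f : P n) (hf : f ∈ HS n s d) :
    PhiL l f ∈ HS n (s + l.length) (d + l.length) := by
  induction l with
  | nil => exact hf
  | cons j l ih => exact Phi_mem j _ ih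

theorem PhiL_rep {n : ℕ} (e : ℕ) (j : Fin n) (z : Fin n → ℕ) :
    PhiL (List.replicate e j) (mon z) =
      mon (fun k => (if k = j then 0 else 2 ^ e - 1) + 2 ^ e * z k) := by
  induction e with
  | zero => simp [PhiL_nil]
  | succ e ih =>
    rw [List.replicate_succ, PhiL_cons, ih, Phi_mon]
    congr 1
    funext k
    have := Nat.one_le_two_pow (n := e)
    rw [pow_succ, mul_comm _ 2, mul_assoc]
    split_ifs <;> omega

theorem swap_rep {n c : ℕ} (e : ℕ) (u v : Fin n) (huv : u ≠ v) (z : Fin n → ℕ)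
    (hz : ∑ k, z k = DD n c) (he : 1 ≤ e) :
    PhiL (u :: List.replicate e v) (mon z) + PhiL (v :: List.replicate e u) (mon z)
      ∈ HS n 2 (c + (e + 1)) := by
  have h := S4 e u v huv z hz he
  have h1 := Nat.one_le_two_pow (n := e)
  apply HS_symm
  convert h using 2
  · rw [PhiL_cons, PhiL_rep, Phi_mon]
    congr 1
    funext k
    unfold mm
    rw [pow_succ, mul_comm _ 2, mul_assoc]
    by_cases hu : k = u
    · subst hu; simp [huv]
    · by_cases hv : k = v
      · subst hv; simp [hu]; omega
      · simp [hu, hv]; omega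
  · rw [PhiL_cons, PhiL_rep, Phi_mon]
    congr 1
    funext k
    unfold mm
    rw [pow_succ, mul_comm _ 2, mul_assoc]
    by_cases hu : k = u
    · subst hu; simp [huv]; omega
    · by_cases hv : k = v
      · subst hv; simp [hu]; omega
      · simp [hu, hv]; omega

theorem PhiL_mon {n c : ℕ} (l : List (Fin n)) (z : Fin n → ℕ) (hz : ∑ k, z k = DD n c) :
    ∃ z', PhiL l (mon z) = mon z' ∧ ∑ k, z' k = DD n (c + l.length) := by
  induction l with
  | nil => exact ⟨z, rfl, hz⟩
  | cons j l ih =>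
    obtain ⟨z', h1, h2⟩ := ih
    refine ⟨_, by rw [PhiL_cons, h1, Phi_mon], ?_⟩
    rw [Finset.sum_add_distrib, ← Finset.mul_sum, h2, List.length_cons, ← Nat.add_assoc, DD_succ]
    have := mdeg_xx j
    simp only [mdeg, ev_apply, xx] at this
    rw [this]

theorem perm_mem {n c : ℕ} (z : Fin n → ℕ) (hz : ∑ k, z k = DD n c) {l l' : List (Fin n)}
    (h : l.Perm l') : PhiL l (mon z) + PhiL l' (mon z) ∈ HS n l.length (c + l.length) := by
  induction h with
  | nil => rw [Psum_self]; exact zero_mem _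
  | cons x _ ih => rw [PhiL_cons, PhiL_cons, ← Phi_add]; exact Phi_mem x _ ih
  | swap x y l =>
    by_cases hxy : x = y
    · subst hxy; rw [Psum_self]; exact zero_mem _
    · obtain ⟨z', h1, h2⟩ := PhiL_mon l z hz
      have := swap_rep 1 y x (Ne.symm hxy) z' h2 le_rfl
      rw [← h1] at this
      have h3 : c + (y :: x :: l).length = c + l.length + (1 + 1) := by simp; omega
      rw [h3]
      exact HS_mono (by simp) this
  | trans p1 p2 ih1 ih2 =>
    rw [← p1.length_eq] at ih2
    exact HS_trans ih1 ih2

theorem single_sum {n : ℕ} (v : Fin n) : ∑ k, (Pi.single v 1 : Fin n → ℕ) k = DD n 0 := by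
  simp [DD]

def TT {n : ℕ} (S : Finset (Fin n)) (v : Fin n) (m : ℕ) : P n :=
  PhiL S.toList (PhiL (List.replicate m v) (mon (Pi.single v 1)))

theorem E_mem {n m : ℕ} (hn : 1 ≤ n) (hm : 1 ≤ m) :
    ∑ v : Fin n, PhiL (List.replicate m v) (mon (Pi.single v 1)) ∈ HS n 1 m := by
  have h1 := Nat.one_le_two_pow (n := m)
  have h := sq1_mem (n := n) (d := m) (fun _ => 2 ^ m - 1) (by
    intro k
    obtain ⟨t, rfl⟩ : ∃ t, m = t + 1 := ⟨m - 1, by omega⟩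
    rw [pow_succ] at *
    omega) (by
    obtain ⟨t, rfl⟩ : ∃ t, n = t + 1 := ⟨n - 1, by omega⟩
    rw [Finset.sum_const, Finset.card_univ, Fintype.card_fin, smul_eq_mul, DD, Nat.add_sub_cancel,
      add_mul]
    omega)
  convert h using 1
  apply Finset.sum_congr rfl
  intro v _
  rw [PhiL_rep]
  congr 1
  funext k
  by_cases hk : k = v
  · subst hk; simp; omega
  · simp [hk]

theorem TT_perm {n m : ℕ} (S : Finset (Fin n)) (v : Fin n) (l : List (Fin n)) (h : l.Perm S.toList) :
    PhiL l (PhiL (List.replicate m v) (mon (Pi.single v 1))) + TT S v m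
      ∈ HS n l.length (m + l.length) := by
  obtain ⟨z', h1, h2⟩ := PhiL_mon (List.replicate m v) (Pi.single v 1) (single_sum v)
  rw [TT, h1]
  rw [zero_add, List.length_replicate] at h2
  exact perm_mem z' h2 h

theorem erase_perm {n : ℕ} (S : Finset (Fin n)) (v : Fin n) (hv : v ∈ S) :
    ((S.erase v).toList ++ [v]).Perm S.toList := by
  have h1 : ((S.erase v).toList ++ [v]).Perm (v :: (S.erase v).toList) := List.perm_append_singleton _ _
  refine h1.trans ?_
  have h2 := Finset.toList_insert (Finset.notMem_erase v S)
  rw [Finset.insert_erase hv] at h2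
  exact h2.symm

theorem TT_erase {n m : ℕ} (S : Finset (Fin n)) (v : Fin n) (hv : v ∈ S) :
    TT S v m + TT (S.erase v) v (m + 1) ∈ HS n S.card (m + S.card) := by
  have hp := erase_perm S v hv
  have h := TT_perm (m := m) S v _ hp
  have hl : ((S.erase v).toList ++ [v]).length = S.card := by rw [hp.length_eq, Finset.length_toList]
  rw [hl, PhiL_append] at h
  exact HS_symm h

def QQ (n d r : ℕ) : P n :=
  ∑ S ∈ Finset.powersetCard r (Finset.univ : Finset (Fin n)), ∑ v ∈ Sᶜ, TT S v (d - r)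

theorem reindex {n : ℕ} (r : ℕ) (G : Finset (Fin n) → Fin n → P n) :
    ∑ S ∈ Finset.powersetCard (r + 1) (Finset.univ : Finset (Fin n)), ∑ v ∈ S, G (S.erase v) v =
    ∑ S ∈ Finset.powersetCard r (Finset.univ : Finset (Fin n)), ∑ v ∈ Sᶜ, G S v := by
  rw [Finset.sum_sigma', Finset.sum_sigma']
  refine Finset.sum_nbij' (fun x => ⟨x.1.erase x.2, x.2⟩) (fun x => ⟨insert x.2 x.1, x.2⟩) ?_ ?_ ?_ ?_ ?_
  · rintro ⟨S, v⟩ h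
    simp only [Finset.mem_sigma, Finset.mem_powersetCard, Finset.subset_univ, true_and] at h
    simp only [Finset.mem_sigma, Finset.mem_powersetCard, Finset.subset_univ, true_and,
      Finset.mem_compl, Finset.notMem_erase, not_false_eq_true, and_true]
    rw [Finset.card_erase_of_mem h.2]; omega
  · rintro ⟨S, v⟩ h
    simp only [Finset.mem_sigma, Finset.mem_powersetCard, Finset.subset_univ, true_and,
      Finset.mem_compl] at h
    simp only [Finset.mem_sigma, Finset.mem_powersetCard, Finset.subset_univ, true_and,
      Finset.mem_insert_self, and_true]
    rw [Finset.card_insert_of_notMem h.2]; omega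
  · rintro ⟨S, v⟩ h
    simp only [Finset.mem_sigma] at h
    simp [Finset.insert_erase h.2]
  · rintro ⟨S, v⟩ h
    simp only [Finset.mem_sigma, Finset.mem_compl] at h
    simp [Finset.erase_insert h.2]
  · intros; rfl

theorem QQ_mem {n d : ℕ} (hn : 2 ≤ n) (hd : n ≤ d) (r : ℕ) (hr : r + 1 ≤ n) :
    QQ n d r ∈ HS n n d := by
  induction r with
  | zero =>
    unfold QQ
    rw [Finset.powersetCard_zero, Finset.sum_singleton, Finset.compl_empty]
    simp only [TT, Finset.toList_empty, PhiL_nil]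
    exact HS_mono (by omega) (E_mem (by omega) (by omega))
  | succ r ih =>
    have ih := ih (by omega)
    have h1 : ∑ S ∈ Finset.powersetCard (r + 1) (Finset.univ : Finset (Fin n)),
        ∑ v, TT S v (d - (r + 1)) ∈ HS n n d := by
      apply Submodule.sum_mem
      intro S hS
      have hc := (Finset.mem_powersetCard.mp hS).2
      have h := PhiL_mem S.toList _ (E_mem (n := n) (m := d - (r + 1)) (by omega) (by omega))
      rw [PhiL_sum, Finset.length_toList, hc, show d - (r + 1) + (r + 1) = d by omega] at h
      exact HS_mono (by omega) h
    have h2 : ∑ S ∈ Finset.powersetCard (r + 1) (Finset.univ : Finset (Fin n)),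
        ∑ v ∈ S, TT S v (d - (r + 1)) + QQ n d r ∈ HS n n d := by
      unfold QQ
      rw [← reindex r (fun S v => TT S v (d - r)), ← Finset.sum_add_distrib]
      apply Submodule.sum_mem
      intro S hS
      have hc := (Finset.mem_powersetCard.mp hS).2
      rw [← Finset.sum_add_distrib]
      apply Submodule.sum_mem
      intro v hv
      have h := TT_erase (m := d - (r + 1)) S v hv
      rw [hc, show d - (r + 1) + (r + 1) = d by omega, show d - (r + 1) + 1 = d - r by omega] at h
      exact HS_mono (by omega) h
    have h3 : ∑ S ∈ Finset.powersetCard (r + 1) (Finset.univ : Finset (Fin n)),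
        ∑ v, TT S v (d - (r + 1)) =
        ∑ S ∈ Finset.powersetCard (r + 1) (Finset.univ : Finset (Fin n)),
        ∑ v ∈ S, TT S v (d - (r + 1)) + QQ n d (r + 1) := by
      unfold QQ
      rw [← Finset.sum_add_distrib]
      apply Finset.sum_congr rfl
      intro S _
      rw [Finset.sum_add_sum_compl]
    rw [h3] at h1
    have h4 := (Submodule.add_mem_iff_left _ ih).mp h2
    exact (Submodule.add_mem_iff_right _ h4).mp h1

theorem QQ_top {n : ℕ} (d : ℕ) (hn : 2 ≤ n) :
    QQ n d (n - 1) = ∑ v : Fin n, TT (Finset.univ.erase v) v (d - (n - 1)) := by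
  unfold QQ
  rw [← reindex (n - 1) (fun S v => TT S v (d - (n - 1))), show n - 1 + 1 = n by omega]
  have : Finset.powersetCard n (Finset.univ : Finset (Fin n)) = {Finset.univ} := by
    have h := Finset.powersetCard_self (Finset.univ : Finset (Fin n))
    rwa [Finset.card_univ, Fintype.card_fin] at h
  rw [this, Finset.sum_singleton]

def descL (n : ℕ) : ℕ → List (Fin n)
  | 0 => []
  | q + 1 => if h : q + 1 < n then ⟨q + 1, h⟩ :: descL n q else descL n q

theorem descL_mem {n : ℕ} (q : ℕ) (hq : q < n) (k : Fin n) : k ∈ descL n q ↔ 1 ≤ (k : ℕ) ∧ (k : ℕ) ≤ q := by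
  induction q with
  | zero => simp [descL]; omega
  | succ q ih =>
    rw [descL, dif_pos hq, List.mem_cons, ih (by omega), Fin.ext_iff]
    simp only
    omega

theorem descL_nodup {n : ℕ} (q : ℕ) (hq : q < n) : (descL n q).Nodup := by
  induction q with
  | zero => simp [descL]
  | succ q ih =>
    rw [descL, dif_pos hq, List.nodup_cons, descL_mem q (by omega)]
    exact ⟨by simp, ih (by omega)⟩

theorem descL_exp {n : ℕ} (q : ℕ) (hq : q < n) (z : Fin n → ℕ) :
    ∃ z', PhiL (descL n q) (mon z) = mon z' ∧
      ∀ k : Fin n, z' k + 1 + (if 1 ≤ (k : ℕ) ∧ (k : ℕ) ≤ q then 2 ^ (q - (k : ℕ)) else 0) =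
        2 ^ q * (z k + 1) := by
  induction q with
  | zero =>
    refine ⟨z, rfl, fun k => ?_⟩
    rw [if_neg (by omega)]; simp
  | succ q ih =>
    obtain ⟨z', h1, h2⟩ := ih (by omega)
    refine ⟨_, by rw [descL, dif_pos hq, PhiL_cons, h1, Phi_mon], fun k => ?_⟩
    have h3 := h2 k
    have h4 : 2 ^ (q + 1) * (z k + 1) = 2 * (2 ^ q * (z k + 1)) := by ring
    rw [h4, ← h3]
    by_cases hk : (k : ℕ) = q + 1
    · rw [if_pos (Fin.ext hk), if_pos (by omega), if_neg (by omega), hk]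
      simp; ring
    · rw [if_neg (fun h => hk (by rw [h]))]
      by_cases hk1 : 1 ≤ (k : ℕ) ∧ (k : ℕ) ≤ q
      · rw [if_pos hk1, if_pos (by omega), show q + 1 - (k : ℕ) = q - k + 1 by omega, pow_succ]
        ring
      · rw [if_neg hk1, if_neg (by omega)]
        ring

theorem perm_desc {n : ℕ} (hn : 2 ≤ n) :
    (descL n (n - 1)).Perm (Finset.univ.erase (⟨0, by omega⟩ : Fin n)).toList := by
  rw [List.perm_ext_iff_of_nodup (descL_nodup _ (by omega)) (Finset.nodup_toList _)]
  intro k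
  rw [descL_mem _ (by omega), Finset.mem_toList, Finset.mem_erase, Ne, Fin.ext_iff]
  have := k.isLt
  simp only [Finset.mem_univ, and_true]
  omega

theorem term_mem {n d : ℕ} (hn : 2 ≤ n) (hd : n ≤ d) (o : Fin n) (ho : o = ⟨0, by omega⟩) (u : Fin n) :
    PhiL (descL n (n - 1)) (PhiL (List.replicate (d - (n - 1)) o) (mon (Pi.single u 1)))
      + TT (Finset.univ.erase u) u (d - (n - 1)) ∈ HS n n d := by
  have hp := perm_desc hn
  rw [← ho] at hp
  have hlen : (descL n (n - 1)).length = n - 1 := by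
    rw [hp.length_eq, Finset.length_toList, Finset.card_erase_of_mem (Finset.mem_univ _)]; simp
  by_cases huo : u = o
  · rw [huo]
    have := TT_perm (m := d - (n - 1)) _ o _ hp
    rw [hlen, show d - (n - 1) + (n - 1) = d by omega] at this
    exact HS_mono (by omega) this
  · have hou : u ∈ Finset.univ.erase o := Finset.mem_erase.mpr ⟨huo, Finset.mem_univ _⟩
    have hou' : o ∈ Finset.univ.erase u := Finset.mem_erase.mpr ⟨Ne.symm huo, Finset.mem_univ _⟩
    obtain ⟨z', h1, h2⟩ := PhiL_mon (List.replicate (d - (n - 1)) o) (Pi.single u 1) (single_sum u)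
    rw [zero_add, List.length_replicate] at h2
    have p1 := hp.trans (erase_perm _ u hou).symm
    have a1 := perm_mem z' h2 p1
    rw [← h1, hlen, show d - (n - 1) + (n - 1) = d by omega, PhiL_append] at a1
    have a2 := PhiL_mem ((Finset.univ.erase o).erase u).toList _
      (swap_rep (d - (n - 1)) u o huo (Pi.single u 1) (single_sum u) (by omega))
    have hc : ((Finset.univ.erase o).erase u).toList.length = n - 2 := by
      rw [Finset.length_toList, Finset.card_erase_of_mem hou,
        Finset.card_erase_of_mem (Finset.mem_univ _)]; simp; omega
    rw [PhiL_add, hc, show 0 + (d - (n - 1) + 1) + (n - 2) = d by omega,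
      show 2 + (n - 2) = n by omega] at a2
    have a3 := TT_perm (m := d - (n - 1)) _ u _ (erase_perm _ o hou')
    rw [(erase_perm _ o hou').length_eq, Finset.length_toList,
      Finset.card_erase_of_mem (Finset.mem_univ _), Finset.card_univ, Fintype.card_fin,
      show d - (n - 1) + (n - 1) = d by omega, PhiL_append, Finset.erase_right_comm] at a3
    exact HS_trans (HS_trans (HS_mono (by omega) a1) a2) (HS_mono (by omega) a3)

theorem sort_eq (n : ℕ) : (Finset.Icc 2 n).sort (· ≤ ·) = List.range' 2 (n - 1) := by
  have h : (Finset.Icc 2 n) = (List.range' 2 (n - 1)).toFinset := by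
    ext k; simp [List.mem_range'_1]; omega
  rw [h, List.toFinset_sort _ List.nodup_range']
  exact (List.pairwise_lt_range' (s := 2) (n := n - 1)).imp (fun h => le_of_lt h)

theorem getD_range' (n t : ℕ) (h : t < n - 1) : (List.range' 2 (n - 1)).getD t 0 = t + 2 := by
  rw [List.getD_eq_getElem _ _ (by simpa using h)]
  simp [add_comm]

theorem nuE_X (m e k : ℕ) (h : k - 1 < m) : nuE (Xexp m e) k = e := by
  unfold nuE
  rw [dif_pos h]; rfl

theorem xIu_one (n : ℕ) (k : Fin n) : xIuExp n (List.range' 2 (n - 1)) 1 k =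
    if (k : ℕ) = 0 then 0 else 2 ^ (n - 1 - (k : ℕ)) := by
  have hk := k.isLt
  unfold xIuExp
  rw [List.length_range']
  have hs : ∑ t ∈ Finset.Icc (1 + 1) (n - 1),
      (if (List.range' 2 (n - 1)).getD (t - 1) 0 = (k : ℕ) + 1 then 2 ^ (n - 1 - t) else 0) =
      ∑ t ∈ Finset.Icc (1 + 1) (n - 1), (if (k : ℕ) = t then 2 ^ (n - 1 - t) else 0) := by
    apply Finset.sum_congr rfl
    intro t ht
    rw [Finset.mem_Icc] at ht
    rw [getD_range' n (t - 1) (by omega)]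
    congr 1
    apply propext
    omega
  rw [hs, Finset.sum_ite_eq]
  simp only [Finset.mem_Icc]
  by_cases h0 : (k : ℕ) = 0
  · have hg : ¬ (List.range' 2 (n - 1)).getD (1 - 1) 0 = (k : ℕ) + 1 := by
      by_cases hn : 0 < n - 1
      · rw [getD_range' n _ (by omega)]; omega
      · have : n - 1 = 0 := by omega
        rw [this, h0]; simp
    rw [if_pos h0, if_neg (show ¬ (1 + 1 ≤ (k : ℕ) ∧ (k : ℕ) ≤ n - 1) by omega), if_neg hg, add_zero]
  · rw [if_neg h0, getD_range' n _ (by omega)]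
    by_cases h1 : (k : ℕ) = 1
    · rw [if_pos (by omega), if_neg (by omega), h1]
      have : 2 ^ (n - 1) = 2 * 2 ^ (n - 1 - 1) := by
        rw [← pow_succ']; congr 1; omega
      omega
    · rw [if_neg (by omega), if_pos (by omega), zero_add]

theorem uCompat_iff {n d : ℕ} (hn : 2 ≤ n) (hd : n ≤ d) (u : ℕ) :
    uCompat (List.range' 2 (n - 1)) u (Xexp (n - 1) (2 ^ d - 1)) ↔ u = 1 := by
  have hlt : 2 ^ (n - 1) < 2 ^ d := Nat.pow_lt_pow_right (by norm_num) (by omega)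
  have h1 := Nat.one_le_two_pow (n := n - 1)
  have hne : List.range' 2 (n - 1) ≠ [] := by
    intro h
    have := congrArg List.length h
    simp at this; omega
  unfold uCompat
  rw [if_neg hne, List.length_range']
  have hnu : ∀ t, 1 ≤ t → t ≤ n - 1 →
      nuE (Xexp (n - 1) (2 ^ d - 1)) ((List.range' 2 (n - 1)).getD (t - 1) 0 - 1) = 2 ^ d - 1 := by
    intro t ht ht'
    rw [getD_range' n _ (by omega), nuE_X _ _ _ (by omega)]
  constructor
  · rintro ⟨hu1, hu2, h3, -⟩
    by_contra hne1
    have := h3 1 le_rfl (by omega)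
    rw [hnu 1 le_rfl (by omega)] at this
    omega
  · rintro rfl
    refine ⟨le_rfl, by omega, fun t _ _ => by omega, ?_, ?_, ?_⟩
    · rw [hnu 1 le_rfl (by omega)]; omega
    · intro t ht _
      rw [hnu 1 le_rfl (by omega), Nat.testBit_two_pow_sub_one]
      simp; omega
    · intro t ht ht'
      rw [hnu t (by omega) ht', Nat.testBit_two_pow_sub_one]
      simp; omega

theorem mapDom {n : ℕ} (e : ℕ) (k : Fin n) :
    Finsupp.mapDomain (fIdx n 1) (Xexp (n - 1) e) k = if (k : ℕ) = 0 then 0 else e := by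
  have hval : ∀ j, (fIdx n 1 j : ℕ) = j + 1 := by
    intro j
    unfold fIdx
    rw [if_neg (by omega)]
  have hk := k.isLt
  split_ifs with h
  · apply Finsupp.mapDomain_of_notMem_range
    rintro ⟨j, hj⟩
    have := hval j
    rw [hj] at this
    omega
  · have : k = fIdx n 1 ⟨(k : ℕ) - 1, by omega⟩ := by
      apply Fin.ext; rw [hval]; simp only; omega
    rw [this, Finsupp.mapDomain_apply]
    · rfl
    · intro i j hij
      have := congrArg Fin.val hij
      rw [hval, hval] at this
      exact Fin.ext (by omega)

theorem phi_eq {n d : ℕ} (hn : 2 ≤ n) (hd : n ≤ d) :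
    phiMon n 1 ((Finset.Icc 2 n).sort (· ≤ ·)) (Xexp (n - 1) (2 ^ d - 1)) =
    mon (fun k : Fin n => if (k : ℕ) = 0 then 2 ^ (n - 1) - 1 else 2 ^ d - 1 - 2 ^ (n - 1 - (k : ℕ))) := by
  rw [sort_eq]
  have hex : ∃ u, uCompat (List.range' 2 (n - 1)) u (Xexp (n - 1) (2 ^ d - 1)) :=
    ⟨1, (uCompat_iff hn hd 1).mpr rfl⟩
  have hch : Classical.choose hex = 1 := (uCompat_iff hn hd _).mp (Classical.choose_spec hex)
  unfold phiMon mon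
  rw [dif_pos hex]
  congr 2
  apply congrArg ev
  funext k
  rw [hch, xIu_one, mapDom, List.length_range']
  by_cases h : (k : ℕ) = 0
  · simp [h]
  · simp [h]

theorem term_eq {n d : ℕ} (hn : 2 ≤ n) (hd : n ≤ d) (u : Fin n) :
    phiMon n 1 ((Finset.Icc 2 n).sort (· ≤ ·)) (Xexp (n - 1) (2 ^ d - 1)) * xvMon n (1 + (u : ℕ)) (2 ^ d)
    = PhiL (descL n (n - 1)) (PhiL (List.replicate (d - (n - 1)) ⟨0, by omega⟩) (mon (Pi.single u 1))) := by
  rw [phi_eq hn hd, PhiL_rep]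
  obtain ⟨z', h1, h2⟩ := descL_exp (n - 1) (by omega : n - 1 < n)
    (fun k => (if k = ⟨0, by omega⟩ then 0 else 2 ^ (d - (n - 1)) - 1) +
      2 ^ (d - (n - 1)) * (Pi.single u 1 : Fin n → ℕ) k)
  rw [h1]
  have hx : xvMon n (1 + (u : ℕ)) (2 ^ d) = mon (fun k => 2 ^ d * (Pi.single u 1 : Fin n → ℕ) k) := by
    unfold xvMon mon
    congr 2
    apply congrArg ev
    funext k
    by_cases h : k = u
    · subst h; simp [add_comm]
    · have : (k : ℕ) ≠ u := fun h' => h (Fin.ext h')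
      simp only [Pi.single_apply, h, if_false]
      rw [if_neg (by omega)]; simp
  rw [hx, mon_mul]
  congr 1
  funext k
  have h3 := h2 k
  have hk := k.isLt
  have hE := Nat.one_le_two_pow (n := d - (n - 1))
  have hN := Nat.one_le_two_pow (n := n - 1)
  have hpd : 2 ^ d = 2 ^ (n - 1) * 2 ^ (d - (n - 1)) := by rw [← pow_add]; congr 1; omega
  simp only [Pi.add_apply]
  generalize (Pi.single u 1 : Fin n → ℕ) k = s at *
  by_cases h0 : (k : ℕ) = 0
  · rw [if_pos (Fin.ext h0), if_neg (by omega)] at h3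
    rw [if_pos h0, hpd, mul_assoc]
    rw [zero_add, mul_add] at h3
    omega
  · rw [if_pos (show 1 ≤ (k : ℕ) ∧ (k : ℕ) ≤ n - 1 by omega),
      if_neg (show ¬ k = ⟨0, by omega⟩ from fun h => h0 (by rw [h]))] at h3
    rw [if_neg h0]
    have h4 : 2 ^ (n - 1) * (2 ^ (d - (n - 1)) - 1 + 2 ^ (d - (n - 1)) * s + 1) = 2 ^ d + 2 ^ d * s := by
      rw [hpd, show 2 ^ (d - (n - 1)) - 1 + 2 ^ (d - (n - 1)) * s + 1 =
        2 ^ (d - (n - 1)) + 2 ^ (d - (n - 1)) * s by omega]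
      ring
    rw [h4] at h3
    have h5 : 2 ^ (n - 1 - (k : ℕ)) < 2 ^ d := Nat.pow_lt_pow_right (by norm_num) (by omega)
    omega

/-- Lemma 3.13: for `n ≥ 2` and `d ≥ n`,
`Y_1 = Σ_{u=1}^{n} φ_{(1;I_1)}(X^{2^d−1}) x_u^{2^d} ∈ A_n^+P_n + P_n^−(ω)` where
`I_1 = (2, …, n)` and `ω = ((n−1)^{(d)}, 1)`. -/
theorem statement14 (n d : ℕ) (hn : 2 ≤ n) (hd : n ≤ d) :
    (∑ u ∈ Finset.Icc 1 n,
        phiMon n 1 ((Finset.Icc 2 n).sort (· ≤ ·)) (Xexp (n - 1) (2 ^ d - 1))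
          * xvMon n u (2 ^ d))
      ∈ AplusS n n ⊔ PnLt n ((n - 1) * (2 ^ d - 1) + 2 ^ d) (wSpike n d) := by
  apply HS_le n n d
  have hI : Finset.Icc 1 n = Finset.Ico 1 (n + 1) := by ext k; simp only [Finset.mem_Icc, Finset.mem_Ico]; omega
  rw [hI, Finset.sum_Ico_eq_sum_range, Nat.add_sub_cancel, Finset.sum_range,
    Finset.sum_congr rfl (fun u _ => term_eq hn hd u)]
  have hQ := QQ_mem hn hd (n - 1) (by omega)
  rw [QQ_top d hn] at hQ
  refine (Submodule.add_mem_iff_left _ hQ).mp ?_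
  rw [← Finset.sum_add_distrib]
  exact Submodule.sum_mem _ (fun u _ => term_mem hn hd _ rfl u)
end
end

section
/- Let V ⊆ (QP_5)_{10} be the F_2-span of the classes [x] of all monomials x of degree 10 in P_5 such that at least one of the variables x_1,…,x_5 does not occur in x and ω(x) = (2,2,1). Then V is stable under the action of the group Σ_5 of variable permutations, and the Σ_5-invariant subspace of V has dimension exactly 4. -/
open MvPolynomial

noncomputable section

/-- The weight vector `(2,2,1)` (zero-based indexing). -/
def w221 : ℕ → ℕ := fun i => if i = 0 then 2 else if i = 1 then 2 else if i = 2 then 1 else 0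

/-- The span in `QP_5` of the classes of the monomials of degree 10 missing at least one
variable and with weight vector `(2,2,1)`. -/
def V15 : Submodule (ZMod 2) (P 5 ⧸ hitS 5) :=
  Submodule.span (ZMod 2)
    {q | ∃ a : Fin 5 →₀ ℕ, mdeg a = 10 ∧ (∃ j, a j = 0) ∧ wt a = w221 ∧
      q = (hitS 5).mkQ (monomial a 1)}

namespace S15

structure M5 where
  a : ℕ
  b : ℕ
  c : ℕ
  d : ℕ
  e : ℕ

def M5.same (x y : M5) : Bool :=
  Nat.beq x.a y.a && (Nat.beq x.b y.b && (Nat.beq x.c y.c && (Nat.beq x.d y.d && Nat.beq x.e y.e)))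

theorem same_eq {x y : M5} (h : x.same y = true) : x = y := by
  cases x; cases y
  simp only [M5.same, Bool.and_eq_true, Nat.beq_eq] at h
  obtain ⟨h1, h2, h3, h4, h5⟩ := h
  simp_all

def M5.deg (x : M5) : ℕ := x.a + (x.b + (x.c + (x.d + x.e)))

def M5.toF (x : M5) : Fin 5 →₀ ℕ := ev ![x.a, x.b, x.c, x.d, x.e]

def ofF (a : Fin 5 →₀ ℕ) : M5 := ⟨a 0, a 1, a 2, a 3, a 4⟩

theorem ofF_toF (x : M5) : ofF x.toF = x := rfl

theorem toF_ofF (a : Fin 5 →₀ ℕ) : (ofF a).toF = a := by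
  ext i; fin_cases i <;> rfl

def mono (x : M5) : P 5 := monomial x.toF 1

def tp (L : List M5) : P 5 := (L.map mono).sum

@[simp] theorem tp_nil : tp [] = 0 := rfl
@[simp] theorem tp_cons (x : M5) (L : List M5) : tp (x :: L) = mono x + tp L := by simp [tp]
@[simp] theorem tp_append (L K : List M5) : tp (L ++ K) = tp L + tp K := by simp [tp]
theorem tp_flatMap {α : Type*} (L : List α) (f : α → List M5) :
    tp (L.flatMap f) = (L.map fun x => tp (f x)).sum := by
  induction L with
  | nil => simp
  | cons x L ih => simp [ih]

theorem mono_eq (x : M5) :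
    mono x = X 0 ^ x.a * (X 1 ^ x.b * (X 2 ^ x.c * (X 3 ^ x.d * X 4 ^ x.e))) := by
  rw [mono, monomial_eq, Finsupp.prod_fintype _ _ (by simp)]
  simp [Fin.prod_univ_five, M5.toF, ev, mul_assoc]

theorem add_self' (p : P 5) : p + p = 0 := CharTwo.add_self_eq_zero p

/-! toggling normal form -/

def tog (x : M5) : List M5 → List M5
  | [] => [x]
  | y :: L => bif x.same y then L else y :: tog x L

theorem tp_tog (x : M5) (L : List M5) : tp (tog x L) = mono x + tp L := by
  induction L with
  | nil => rfl
  | cons y L ih =>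
    rw [tog]
    cases h : x.same y
    · simp only [cond_false, tp_cons, ih]; ring
    · have := same_eq h
      subst this
      simp only [cond_true, tp_cons]
      rw [← add_assoc, add_self', zero_add]

def nrm (L : List M5) : List M5 := L.foldr tog []

theorem tp_nrm (L : List M5) : tp (nrm L) = tp L := by
  induction L with
  | nil => rfl
  | cons x L ih => rw [nrm, List.foldr_cons, tp_tog, ← nrm, ih, tp_cons]

theorem tp_zero {L : List M5} (h : (nrm L).isEmpty = true) : tp L = 0 := by
  rw [← tp_nrm, List.isEmpty_iff.1 h]; rfl

/-! squares in one variable -/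

def s1 : ℕ → List ℕ
  | 0 => [0]
  | 1 => [1, 2]
  | 2 => [2, 4]
  | 3 => [3, 4, 5, 6]
  | 4 => [4, 8]
  | 5 => [5, 6, 9, 10]
  | 6 => [6, 8, 10, 12]
  | 7 => [7, 8, 9, 10, 11, 12, 13, 14]
  | 8 => [8, 16]
  | 9 => [9, 10, 17, 18]
  | _ => []

theorem s1_ok (x : P 5) (a : ℕ) (h : a ≤ 9) : (x + x ^ 2) ^ a = ((s1 a).map (x ^ ·)).sum := by
  have h2 : (2 : P 5) = 0 := CharTwo.two_eq_zero
  interval_cases a <;> simp [s1] <;> grind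

def full (m : M5) : List M5 :=
  (s1 m.a).flatMap fun a => (s1 m.b).flatMap fun b => (s1 m.c).flatMap fun c =>
    (s1 m.d).flatMap fun d => (s1 m.e).map fun e => ⟨a, b, c, d, e⟩

def M5.small (m : M5) : Prop := m.a ≤ 9 ∧ m.b ≤ 9 ∧ m.c ≤ 9 ∧ m.d ≤ 9 ∧ m.e ≤ 9

theorem small_of_deg {m : M5} (h : m.deg ≤ 9) : m.small := by
  unfold M5.deg at h; unfold M5.small; omega

theorem sqTot_mono (m : M5) (h : m.small) : sqTot 5 (mono m) = tp (full m) := by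
  obtain ⟨ha, hb, hc, hd, he⟩ := h
  rw [mono_eq]
  simp only [map_mul, map_pow, sqTot, bind₁_X_right]
  rw [s1_ok _ _ ha, s1_ok _ _ hb, s1_ok _ _ hc, s1_ok _ _ hd, s1_ok _ _ he]
  simp only [full, tp_flatMap]
  simp only [tp, List.map_map, Function.comp_def, mono_eq,
    List.sum_map_mul_left, List.sum_map_mul_right]

theorem mono_hom (m : M5) : (mono m).IsHomogeneous m.deg := by
  apply isHomogeneous_monomial
  rw [Finsupp.degree_eq_sum]
  simp [Fin.sum_univ_five, M5.toF, ev, M5.deg]; ring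

theorem hc_mono (n : ℕ) (m : M5) :
    homogeneousComponent n (mono m) = if m.deg = n then mono m else 0 := by
  rw [homogeneousComponent_of_mem (mono_hom m)]
  simp [eq_comm]

theorem hc_tp (n : ℕ) (L : List M5) :
    homogeneousComponent n (tp L) = tp (L.filter fun m => Nat.beq m.deg n) := by
  induction L with
  | nil => simp
  | cons x L ih =>
    rw [tp_cons, map_add, ih, hc_mono, List.filter_cons]
    by_cases h : x.deg = n <;> simp [h]

theorem totalDegree_mono (m : M5) : (mono m).totalDegree = m.deg := by
  apply (mono_hom m).totalDegree
  simp [mono]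

theorem SqK_mono (j : ℕ) (m : M5) :
    SqK 5 j (mono m) = homogeneousComponent (m.deg + j) (sqTot 5 (mono m)) := by
  rw [SqK, Finset.sum_eq_single m.deg]
  · rw [hc_mono, if_pos rfl]
  · intro d _ hd
    rw [hc_mono, if_neg (Ne.symm hd)]; simp
  · intro h
    simp [totalDegree_mono] at h

def sqL (m : M5) : List M5 := (full m).filter fun m => Nat.beq m.deg 10

theorem sqL_hit (m : M5) (h : m.deg ≤ 9) : tp (sqL m) ∈ hitS 5 := by
  apply Submodule.subset_span
  refine ⟨10 - m.deg, by omega, mono m, ?_⟩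
  rw [SqK_mono, sqTot_mono m (small_of_deg h), hc_tp, sqL, show m.deg + (10 - m.deg) = 10 by omega]

/-! renaming -/

theorem SqK_rename (σ : Equiv.Perm (Fin 5)) (j : ℕ) (h : P 5) :
    rename σ (SqK 5 j h) = SqK 5 j (rename σ h) := by
  have hd : (rename σ h).totalDegree = h.totalDegree := by
    apply le_antisymm (totalDegree_rename_le _ _)
    conv_lhs => rw [show h = rename σ.symm (rename σ h) by simp [rename_rename]]
    exact totalDegree_rename_le _ _
  have hs : ∀ p : P 5, rename σ (sqTot 5 p) = sqTot 5 (rename σ p) := by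
    intro p
    rw [sqTot, rename_bind₁, bind₁_rename]
    congr 2
    ext i; simp
  simp only [SqK, map_sum, hd, rename_homogeneousComponent, hs]

theorem hit_rename (σ : Equiv.Perm (Fin 5)) {p : P 5} (hp : p ∈ hitS 5) :
    rename σ p ∈ hitS 5 := by
  have : hitS 5 ≤ (hitS 5).comap (rename (R := ZMod 2) σ).toLinearMap := by
    refine Submodule.span_le.2 ?_
    rintro _ ⟨j, hj, h, rfl⟩
    exact Submodule.subset_span ⟨j, hj, rename σ h, SqK_rename σ j h⟩
  exact this hp

def gen (k : Fin 4) : Equiv.Perm (Fin 5) := Equiv.swap k.castSucc k.succ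

def sw : Fin 4 → M5 → M5
  | 0, ⟨a, b, c, d, e⟩ => ⟨b, a, c, d, e⟩
  | 1, ⟨a, b, c, d, e⟩ => ⟨a, c, b, d, e⟩
  | 2, ⟨a, b, c, d, e⟩ => ⟨a, b, d, c, e⟩
  | 3, ⟨a, b, c, d, e⟩ => ⟨a, b, c, e, d⟩

theorem rename_sw (k : Fin 4) (m : M5) : rename (gen k) (mono m) = mono (sw k m) := by
  rw [mono_eq, mono_eq]
  obtain ⟨a, b, c, d, e⟩ := m
  have h : ∀ k : Fin 4, ∀ i : Fin 5, gen k i = (Equiv.swap k.castSucc k.succ) i := fun _ _ => rfl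
  fin_cases k
  · have h0 : gen 0 0 = 1 := by decide
    have h1 : gen 0 1 = 0 := by decide
    have h2 : gen 0 2 = 2 := by decide
    have h3 : gen 0 3 = 3 := by decide
    have h4 : gen 0 4 = 4 := by decide
    simp [sw, h0, h1, h2, h3, h4]; ring
  · have h0 : gen 1 0 = 0 := by decide
    have h1 : gen 1 1 = 2 := by decide
    have h2 : gen 1 2 = 1 := by decide
    have h3 : gen 1 3 = 3 := by decide
    have h4 : gen 1 4 = 4 := by decide
    simp [sw, h0, h1, h2, h3, h4]; ring
  · have h0 : gen 2 0 = 0 := by decide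
    have h1 : gen 2 1 = 1 := by decide
    have h2 : gen 2 2 = 3 := by decide
    have h3 : gen 2 3 = 2 := by decide
    have h4 : gen 2 4 = 4 := by decide
    simp [sw, h0, h1, h2, h3, h4]; ring
  · have h0 : gen 3 0 = 0 := by decide
    have h1 : gen 3 1 = 1 := by decide
    have h2 : gen 3 2 = 2 := by decide
    have h3 : gen 3 3 = 4 := by decide
    have h4 : gen 3 4 = 3 := by decide
    simp [sw, h0, h1, h2, h3, h4]; ring

def R (k : Fin 4) : P 5 →ₗ[ZMod 2] P 5 := (rename (R := ZMod 2) (gen k)).toLinearMap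

theorem R_mono (k : Fin 4) (m : M5) : R k (mono m) = mono (sw k m) := rename_sw k m

theorem R_tp (k : Fin 4) (L : List M5) : R k (tp L) = tp (L.map (sw k)) := by
  induction L with
  | nil => simp
  | cons x L ih => rw [tp_cons, map_add, ih, R_mono, List.map_cons, tp_cons]

def act : List (Fin 4) → M5 → M5
  | [], m => m
  | k :: w, m => act w (sw k m)

def Rw : List (Fin 4) → P 5 →ₗ[ZMod 2] P 5
  | [] => LinearMap.id
  | k :: w => Rw w ∘ₗ R k

theorem Rw_mono (w : List (Fin 4)) (m : M5) : Rw w (mono m) = mono (act w m) := by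
  induction w generalizing m with
  | nil => rfl
  | cons k w ih => simp only [Rw, LinearMap.comp_apply, R_mono, ih, act]

theorem hit_R (k : Fin 4) {p : P 5} (hp : p ∈ hitS 5) : R k p ∈ hitS 5 := hit_rename _ hp

theorem hit_Rw (w : List (Fin 4)) {p : P 5} (hp : p ∈ hitS 5) : Rw w p ∈ hitS 5 := by
  induction w generalizing p with
  | nil => exact hp
  | cons k w ih => exact ih (hit_R k hp)

/-! computed data -/

def tab2 : List (M5 × ℕ) := [
  (⟨3,7,0,0,0⟩, 1), (⟨7,3,0,0,0⟩, 2)]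

def tab3 : List (M5 × ℕ) := [
  (⟨1,2,7,0,0⟩, 4), (⟨1,3,6,0,0⟩, 8), (⟨1,6,3,0,0⟩, 16), (⟨1,7,2,0,0⟩, 32), (⟨2,1,7,0,0⟩, 4),
  (⟨2,3,5,0,0⟩, 8), (⟨2,5,3,0,0⟩, 16), (⟨2,7,1,0,0⟩, 32), (⟨3,1,6,0,0⟩, 64), (⟨3,2,5,0,0⟩, 64),
  (⟨3,3,4,0,0⟩, 128), (⟨3,4,3,0,0⟩, 152), (⟨3,5,2,0,0⟩, 256), (⟨3,6,1,0,0⟩, 256),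
  (⟨4,3,3,0,0⟩, 24), (⟨5,2,3,0,0⟩, 216), (⟨5,3,2,0,0⟩, 384), (⟨6,1,3,0,0⟩, 216),
  (⟨6,3,1,0,0⟩, 384), (⟨7,1,2,0,0⟩, 512), (⟨7,2,1,0,0⟩, 512)]

def tab4 : List (M5 × ℕ) := [
  (⟨1,1,2,6,0⟩, 1024), (⟨1,1,6,2,0⟩, 2048), (⟨1,2,1,6,0⟩, 4096), (⟨1,2,2,5,0⟩, 5120),
  (⟨1,2,3,4,0⟩, 8192), (⟨1,2,4,3,0⟩, 16384), (⟨1,2,5,2,0⟩, 32768), (⟨1,2,6,1,0⟩, 34816),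
  (⟨1,3,2,4,0⟩, 65536), (⟨1,3,4,2,0⟩, 131072), (⟨1,4,2,3,0⟩, 21504), (⟨1,4,3,2,0⟩, 40960),
  (⟨1,5,2,2,0⟩, 196608), (⟨1,6,1,2,0⟩, 262144), (⟨1,6,2,1,0⟩, 458752), (⟨2,1,1,6,0⟩, 5120),
  (⟨2,1,2,5,0⟩, 4096), (⟨2,1,3,4,0⟩, 8192), (⟨2,1,4,3,0⟩, 16384), (⟨2,1,5,2,0⟩, 34816),
  (⟨2,1,6,1,0⟩, 32768), (⟨2,2,1,5,0⟩, 1024), (⟨2,2,5,1,0⟩, 2048), (⟨2,3,1,4,0⟩, 65536),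
  (⟨2,3,4,1,0⟩, 131072), (⟨2,4,1,3,0⟩, 21504), (⟨2,4,3,1,0⟩, 40960), (⟨2,5,1,2,0⟩, 458752),
  (⟨2,5,2,1,0⟩, 262144), (⟨2,6,1,1,0⟩, 196608), (⟨3,1,2,4,0⟩, 524288), (⟨3,1,4,2,0⟩, 1048576),
  (⟨3,2,1,4,0⟩, 524288), (⟨3,2,4,1,0⟩, 1048576), (⟨3,4,1,2,0⟩, 2097152), (⟨3,4,2,1,0⟩, 2097152),
  (⟨4,1,2,3,0⟩, 20480), (⟨4,1,3,2,0⟩, 43008), (⟨4,2,1,3,0⟩, 20480), (⟨4,2,3,1,0⟩, 43008),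
  (⟨4,3,1,2,0⟩, 393216), (⟨4,3,2,1,0⟩, 393216), (⟨5,1,2,2,0⟩, 1572864), (⟨5,2,1,2,0⟩, 2621440),
  (⟨5,2,2,1,0⟩, 3145728), (⟨6,1,1,2,0⟩, 3145728), (⟨6,1,2,1,0⟩, 2621440), (⟨6,2,1,1,0⟩, 1572864),
  (⟨2,2,3,3,0⟩, 24576), (⟨2,3,2,3,0⟩, 87040), (⟨2,3,3,2,0⟩, 172032), (⟨3,2,2,3,0⟩, 544768),
  (⟨3,2,3,2,0⟩, 1091584), (⟨3,3,2,2,0⟩, 2490368), (⟨1,1,5,3,0⟩, 24576), (⟨1,5,1,3,0⟩, 87040),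
  (⟨1,5,3,1,0⟩, 172032), (⟨5,1,1,3,0⟩, 544768), (⟨5,1,3,1,0⟩, 1091584), (⟨5,3,1,1,0⟩, 2490368)]

def cert : List (M5 × List M5) := [
  (⟨2,1,7,0,0⟩, [⟨1,1,4,0,0⟩, ⟨1,1,7,0,0⟩]),
  (⟨2,3,5,0,0⟩, [⟨1,2,2,0,0⟩, ⟨1,3,5,0,0⟩, ⟨1,4,3,0,0⟩]),
  (⟨2,5,3,0,0⟩, [⟨2,5,2,0,0⟩, ⟨1,5,2,0,0⟩, ⟨1,5,3,0,0⟩]),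
  (⟨2,7,1,0,0⟩, [⟨1,4,1,0,0⟩, ⟨1,7,1,0,0⟩]),
  (⟨3,2,5,0,0⟩, [⟨1,1,5,0,0⟩, ⟨2,1,5,0,0⟩, ⟨3,1,5,0,0⟩]),
  (⟨3,4,3,0,0⟩, [⟨2,5,2,0,0⟩, ⟨1,5,2,0,0⟩, ⟨3,3,3,0,0⟩, ⟨1,3,5,0,0⟩, ⟨1,4,3,0,0⟩, ⟨1,5,3,0,0⟩, ⟨2,3,3,0,0⟩]),
  (⟨3,6,1,0,0⟩, [⟨2,5,2,0,0⟩, ⟨2,5,1,0,0⟩, ⟨3,5,1,0,0⟩]),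
  (⟨4,3,3,0,0⟩, [⟨2,5,2,0,0⟩, ⟨1,5,2,0,0⟩, ⟨1,3,5,0,0⟩, ⟨1,4,3,0,0⟩, ⟨1,5,3,0,0⟩, ⟨2,3,3,0,0⟩]),
  (⟨5,2,3,0,0⟩, [⟨1,3,4,0,0⟩, ⟨1,2,5,0,0⟩, ⟨2,1,3,0,0⟩, ⟨1,5,3,0,0⟩, ⟨2,3,3,0,0⟩, ⟨3,1,5,0,0⟩, ⟨3,3,3,0,0⟩, ⟨1,3,5,0,0⟩, ⟨3,2,3,0,0⟩]),
  (⟨5,3,2,0,0⟩, [⟨4,3,2,0,0⟩, ⟨3,3,2,0,0⟩]),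
  (⟨6,1,3,0,0⟩, [⟨1,2,5,0,0⟩, ⟨2,1,5,0,0⟩, ⟨3,1,4,0,0⟩, ⟨1,3,4,0,0⟩, ⟨5,1,3,0,0⟩, ⟨3,3,3,0,0⟩, ⟨1,3,5,0,0⟩, ⟨1,5,3,0,0⟩, ⟨3,1,5,0,0⟩, ⟨3,2,3,0,0⟩, ⟨2,3,3,0,0⟩]),
  (⟨6,3,1,0,0⟩, [⟨3,4,1,0,0⟩, ⟨3,3,2,0,0⟩, ⟨5,3,1,0,0⟩]),
  (⟨7,2,1,0,0⟩, [⟨4,1,1,0,0⟩, ⟨7,1,1,0,0⟩]), (⟨1,2,2,5,0⟩, [⟨2,1,1,5,0⟩, ⟨1,1,1,5,0⟩]),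
  (⟨1,2,6,1,0⟩, [⟨2,1,5,1,0⟩, ⟨1,1,5,1,0⟩]),
  (⟨1,4,2,3,0⟩, [⟨2,1,1,5,0⟩, ⟨1,2,2,3,0⟩, ⟨1,1,1,3,0⟩]),
  (⟨1,4,3,2,0⟩, [⟨2,2,3,2,0⟩, ⟨1,2,3,2,0⟩]), (⟨1,5,2,2,0⟩, [⟨1,4,2,2,0⟩, ⟨1,3,2,2,0⟩]),
  (⟨1,6,2,1,0⟩, [⟨2,5,1,1,0⟩, ⟨1,3,2,2,0⟩, ⟨1,3,1,1,0⟩]), (⟨2,1,1,6,0⟩, [⟨1,1,1,6,0⟩]),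
  (⟨2,1,2,5,0⟩, [⟨1,1,1,6,0⟩, ⟨1,2,1,5,0⟩, ⟨1,1,1,5,0⟩]),
  (⟨2,1,3,4,0⟩, [⟨2,2,3,2,0⟩, ⟨1,1,4,2,0⟩, ⟨1,1,3,4,0⟩]),
  (⟨2,1,4,3,0⟩, [⟨2,2,3,2,0⟩, ⟨1,1,4,3,0⟩, ⟨1,1,4,2,0⟩]), (⟨2,1,5,2,0⟩, [⟨1,1,5,2,0⟩]),
  (⟨2,1,6,1,0⟩, [⟨1,1,6,1,0⟩, ⟨2,1,5,1,0⟩, ⟨1,1,5,1,0⟩]),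
  (⟨2,2,1,5,0⟩, [⟨1,1,1,6,0⟩, ⟨1,1,2,5,0⟩, ⟨1,1,1,5,0⟩]),
  (⟨2,2,5,1,0⟩, [⟨1,2,5,1,0⟩, ⟨2,1,5,1,0⟩, ⟨1,1,5,1,0⟩]),
  (⟨2,3,1,4,0⟩, [⟨2,2,2,3,0⟩, ⟨1,2,1,4,0⟩, ⟨1,3,1,4,0⟩]),
  (⟨2,3,4,1,0⟩, [⟨1,4,2,2,0⟩, ⟨1,4,2,1,0⟩, ⟨1,3,4,1,0⟩]),
  (⟨2,4,1,3,0⟩, [⟨1,2,1,4,0⟩, ⟨1,4,1,3,0⟩, ⟨2,1,1,5,0⟩, ⟨1,2,2,3,0⟩, ⟨1,1,1,5,0⟩]),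
  (⟨2,4,3,1,0⟩, [⟨1,4,3,1,0⟩, ⟨1,2,4,1,0⟩, ⟨1,2,3,2,0⟩]),
  (⟨2,5,1,2,0⟩, [⟨1,4,2,2,0⟩, ⟨1,5,1,2,0⟩, ⟨1,3,2,2,0⟩]),
  (⟨2,5,2,1,0⟩, [⟨1,5,1,2,0⟩, ⟨1,6,1,1,0⟩, ⟨1,5,1,1,0⟩]),
  (⟨2,6,1,1,0⟩, [⟨2,5,1,1,0⟩, ⟨1,6,1,1,0⟩, ⟨1,3,2,2,0⟩, ⟨1,3,1,1,0⟩]),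
  (⟨3,2,1,4,0⟩, [⟨4,1,1,1,0⟩, ⟨4,1,1,2,0⟩, ⟨3,1,1,4,0⟩]),
  (⟨3,2,4,1,0⟩, [⟨2,2,3,2,0⟩, ⟨2,1,4,1,0⟩, ⟨3,1,4,1,0⟩]),
  (⟨3,4,2,1,0⟩, [⟨4,1,1,1,0⟩, ⟨4,2,1,1,0⟩, ⟨3,4,1,1,0⟩]),
  (⟨4,1,2,3,0⟩, [⟨1,1,2,4,0⟩, ⟨1,2,1,5,0⟩, ⟨1,1,1,6,0⟩, ⟨2,1,2,3,0⟩, ⟨1,1,4,3,0⟩, ⟨1,1,1,5,0⟩]),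
  (⟨4,1,3,2,0⟩, [⟨1,1,5,2,0⟩, ⟨1,1,4,2,0⟩, ⟨2,1,3,2,0⟩, ⟨1,1,3,4,0⟩]),
  (⟨4,2,1,3,0⟩, [⟨2,1,2,4,0⟩, ⟨1,2,1,4,0⟩, ⟨1,4,1,3,0⟩, ⟨1,2,1,5,0⟩, ⟨2,2,1,3,0⟩, ⟨1,2,2,3,0⟩]),
  (⟨4,2,3,1,0⟩, [⟨2,2,3,2,0⟩, ⟨1,1,5,2,0⟩, ⟨2,1,4,1,0⟩, ⟨4,1,3,1,0⟩, ⟨1,1,4,2,0⟩, ⟨2,1,3,2,0⟩, ⟨1,1,3,4,0⟩]),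
  (⟨4,3,1,2,0⟩, [⟨2,2,2,3,0⟩, ⟨1,5,1,2,0⟩, ⟨2,3,1,2,0⟩, ⟨1,2,1,4,0⟩, ⟨1,3,1,4,0⟩, ⟨1,3,2,2,0⟩]),
  (⟨4,3,2,1,0⟩, [⟨1,4,2,1,0⟩, ⟨1,5,1,2,0⟩, ⟨1,3,4,1,0⟩, ⟨2,3,2,1,0⟩, ⟨1,6,1,1,0⟩, ⟨1,5,1,1,0⟩]),
  (⟨5,1,2,2,0⟩, [⟨4,1,1,1,0⟩, ⟨3,1,2,2,0⟩]),
  (⟨5,2,1,2,0⟩, [⟨3,1,1,4,0⟩, ⟨4,1,1,2,0⟩, ⟨3,2,1,2,0⟩]),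
  (⟨5,2,2,1,0⟩, [⟨2,2,3,2,0⟩, ⟨4,2,1,1,0⟩, ⟨2,1,4,1,0⟩, ⟨3,1,4,1,0⟩, ⟨3,4,1,1,0⟩, ⟨3,2,2,1,0⟩]),
  (⟨6,1,1,2,0⟩, [⟨4,2,2,1,0⟩, ⟨3,1,1,4,0⟩, ⟨5,1,1,2,0⟩, ⟨4,1,1,2,0⟩, ⟨3,1,2,2,0⟩, ⟨3,2,1,2,0⟩]),
  (⟨6,1,2,1,0⟩, [⟨4,1,1,2,0⟩, ⟨5,1,1,2,0⟩, ⟨3,1,1,4,0⟩, ⟨5,1,1,1,0⟩, ⟨3,2,1,2,0⟩, ⟨5,2,1,1,0⟩]),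
  (⟨6,2,1,1,0⟩, [⟨3,1,2,2,0⟩, ⟨6,1,1,1,0⟩, ⟨5,2,1,1,0⟩, ⟨3,1,1,1,0⟩])]

def bas2 : List (ℕ × M5) := [
  (0, ⟨3,7,0,0,0⟩), (1, ⟨7,3,0,0,0⟩)]

def bas3 : List (ℕ × M5) := [
  (2, ⟨1,2,7,0,0⟩), (3, ⟨1,3,6,0,0⟩), (4, ⟨1,6,3,0,0⟩), (5, ⟨1,7,2,0,0⟩), (6, ⟨3,1,6,0,0⟩),
  (7, ⟨3,3,4,0,0⟩), (8, ⟨3,5,2,0,0⟩), (9, ⟨7,1,2,0,0⟩)]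

def bas4 : List (ℕ × M5) := [
  (10, ⟨1,1,2,6,0⟩), (11, ⟨1,1,6,2,0⟩), (12, ⟨1,2,1,6,0⟩), (13, ⟨1,2,3,4,0⟩), (14, ⟨1,2,4,3,0⟩),
  (15, ⟨1,2,5,2,0⟩), (16, ⟨1,3,2,4,0⟩), (17, ⟨1,3,4,2,0⟩), (18, ⟨1,6,1,2,0⟩), (19, ⟨3,1,2,4,0⟩),
  (20, ⟨3,1,4,2,0⟩), (21, ⟨3,4,1,2,0⟩)]

def wd2 : List (List (Fin 4)) := [
  [], [1], [2, 1], [3, 2, 1], [0, 1], [0, 2, 1], [0, 3, 2, 1], [1, 0, 2, 1], [1, 0, 3, 2, 1],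
  [2, 1, 0, 3, 2, 1]]

def wd3 : List (List (Fin 4)) := [
  [], [2], [3, 2], [1, 2], [1, 3, 2], [2, 1, 3, 2], [0, 1, 2], [0, 1, 3, 2], [0, 2, 1, 3, 2],
  [1, 0, 2, 1, 3, 2]]

def wd4 : List (List (Fin 4)) := [
  [], [3], [2, 3], [1, 2, 3], [0, 1, 2, 3]]

def rels : List (List (ℕ × List (Fin 4))) := [
  [(1, []), (0, []), (0, [0]), (0, [])],
  [(3, []), (3, [0]), (3, []), (7, [0]), (7, []), (6, [1]), (6, [])],
  [(5, []), (2, []), (2, [1]), (2, [])],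
  [(6, []), (4, []), (7, [0]), (7, []), (6, [1]), (6, [])],
  [(7, []), (4, []), (3, [0]), (3, []), (7, [0]), (7, []), (3, [1]), (3, []), (6, [1]), (6, [])],
  [(8, []), (4, []), (7, [0]), (7, [])],
  [(9, []), (2, []), (5, [0]), (5, []), (2, [1]), (2, [])],
  [(11, []), (10, []), (11, [0]), (11, []), (10, [2]), (10, [])],
  [(12, []), (10, [0]), (10, [])],
  [(13, []), (10, []), (10, [0]), (10, []), (10, [1]), (10, []), (13, [2]), (13, [])],
  [(14, []), (10, []), (10, [0]), (10, []), (10, [1]), (10, [])],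
  [(15, []), (11, [0]), (11, [])],
  [(16, []), (10, []), (10, [0]), (10, []), (11, [0]), (11, []), (10, [1]), (10, []), (13, [1]), (13, []), (15, [1]), (15, []), (13, [2]), (13, [])],
  [(17, []), (11, [0]), (11, []), (15, [1]), (15, [])],
  [(18, []), (10, []), (11, [0]), (11, []), (11, [1]), (11, []), (10, [2]), (10, [])],
  [(19, []), (10, []), (10, [0]), (10, []), (11, [0]), (11, []), (16, [0]), (16, []), (10, [1]), (10, []), (13, [1]), (13, []), (15, [1]), (15, []), (13, [2]), (13, [])],
  [(20, []), (10, []), (17, [0]), (17, []), (18, [0]), (18, []), (11, [1]), (11, []), (15, [1]), (15, []), (10, [2]), (10, [])],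
  [(21, []), (10, []), (11, [0]), (11, []), (18, [0]), (18, []), (11, [1]), (11, []), (10, [2]), (10, [])]]

def invs : Fin 4 → List M5
  | 0 => wd2.flatMap fun w => [
      ⟨3,7,0,0,0⟩, ⟨7,3,0,0,0⟩].map (act w.reverse)
  | 1 => wd3.flatMap fun w => [
      ⟨1,2,7,0,0⟩, ⟨1,7,2,0,0⟩, ⟨7,1,2,0,0⟩].map (act w.reverse)
  | 2 => wd3.flatMap fun w => [
      ⟨1,6,3,0,0⟩, ⟨3,1,6,0,0⟩, ⟨3,3,4,0,0⟩, ⟨3,5,2,0,0⟩].map (act w.reverse)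
  | 3 => wd4.flatMap fun w => [
      ⟨1,1,2,6,0⟩, ⟨1,1,6,2,0⟩, ⟨1,2,3,4,0⟩, ⟨1,2,4,3,0⟩, ⟨1,3,2,4,0⟩, ⟨1,6,1,2,0⟩, ⟨3,1,2,4,0⟩,
      ⟨3,1,4,2,0⟩, ⟨3,4,1,2,0⟩].map (act w.reverse)

def pv : Fin 4 → ℕ
  | 0 => 0
  | 1 => 2
  | 2 => 4
  | 3 => 10

def look : List (M5 × ℕ) → M5 → ℕ
  | [], _ => 0
  | x :: t, m => bif x.1.same m then x.2 else look t m

def lookc : List (M5 × List M5) → M5 → List M5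
  | [], _ => []
  | x :: t, m => bif x.1.same m then x.2 else lookc t m

def val0 (m : M5) : ℕ :=
  bif Nat.beq m.e 0 then
    bif Nat.beq (m.a * m.b) 0 then 0 else
      bif Nat.beq m.d 0 then
        bif Nat.beq m.c 0 then look tab2 m else look tab3 m
      else bif Nat.beq m.c 0 then 0 else look tab4 m
  else 0

def val (m : M5) : ℕ := bif Nat.beq m.deg 10 then val0 m else 0

def xo : List M5 → ℕ
  | [] => 0
  | m :: L => Nat.xor (val m) (xo L)

def upTo9 (p : M5 → Bool) : Bool :=
  (List.range 10).all fun a => (List.range (10 - a)).all fun b =>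
    (List.range (10 - a - b)).all fun c => (List.range (10 - a - b - c)).all fun d =>
      (List.range (10 - a - b - c - d)).all fun e => p ⟨a, b, c, d, e⟩

theorem upTo9_spec {p : M5 → Bool} (h : upTo9 p = true) (m : M5) (hm : m.deg ≤ 9) :
    p m = true := by
  obtain ⟨a, b, c, d, e⟩ := m
  simp only [upTo9, List.all_eq_true, List.mem_range] at h
  simp only [M5.deg] at hm
  exact h a (by omega) b (by omega) c (by omega) d (by omega) e (by omega)

def at10 (p : M5 → Bool) : Bool :=
  (List.range 11).all fun a => (List.range (11 - a)).all fun b =>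
    (List.range (11 - a - b)).all fun c => (List.range (11 - a - b - c)).all fun d =>
      p ⟨a, b, c, d, 10 - a - b - c - d⟩

theorem at10_spec {p : M5 → Bool} (h : at10 p = true) (m : M5) (hm : m.deg = 10) :
    p m = true := by
  obtain ⟨a, b, c, d, e⟩ := m
  simp only [at10, List.all_eq_true, List.mem_range] at h
  simp only [M5.deg] at hm
  have := h a (by omega) b (by omega) c (by omega) d (by omega)
  rwa [show 10 - a - b - c - d = e by omega] at this

def M5.nz (m : M5) : ℕ :=
  (bif Nat.beq m.a 0 then 0 else 1) + ((bif Nat.beq m.b 0 then 0 else 1) +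
    ((bif Nat.beq m.c 0 then 0 else 1) + ((bif Nat.beq m.d 0 then 0 else 1) +
      (bif Nat.beq m.e 0 then 0 else 1))))

def isW (m : M5) : Bool :=
  Nat.beq m.deg 10 && (Nat.beq (m.a % 2 + m.b % 2 + m.c % 2 + m.d % 2 + m.e % 2) 2 &&
  (Nat.beq (m.a / 2 % 2 + m.b / 2 % 2 + m.c / 2 % 2 + m.d / 2 % 2 + m.e / 2 % 2) 2 &&
  (Nat.beq (m.a / 4 % 2 + m.b / 4 % 2 + m.c / 4 % 2 + m.d / 4 % 2 + m.e / 4 % 2) 1 &&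
  ((Nat.ble m.a 7 && (Nat.ble m.b 7 && (Nat.ble m.c 7 && (Nat.ble m.d 7 && Nat.ble m.e 7)))) &&
  (Nat.beq m.a 0 || (Nat.beq m.b 0 || (Nat.beq m.c 0 || (Nat.beq m.d 0 || Nat.beq m.e 0))))))))

structure Wd where
  s : ℕ
  w : List (Fin 4)
  bas : List (ℕ × M5)

def wds : List Wd := wd2.map (⟨2, ·, bas2⟩) ++ (wd3.map (⟨3, ·, bas3⟩) ++ wd4.map (⟨4, ·, bas4⟩))

def eL (m : M5) : List M5 := wds.flatMap fun x =>
  bif Nat.beq (val (act x.w m)) 0 then [] else x.bas.flatMap fun y =>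
    bif (val (act x.w m)).testBit y.1 then [act x.w.reverse y.2] else []

def crt (m : M5) : List M5 := wds.flatMap fun x =>
  bif Nat.beq x.s m.nz then (lookc cert (act x.w m)).map (act x.w.reverse) else []

def chkE (m : M5) : Bool :=
  (nrm (m :: (eL m ++ (crt m).flatMap sqL))).isEmpty && (crt m).all fun z => Nat.ble z.deg 9

def bx (m : M5) : List (ℕ × List (Fin 4)) → Bool
  | [] => false
  | t :: L => (val (act t.2 m)).testBit t.1 ^^ bx m L

def chkR (m : M5) : Bool := rels.all fun r => !(bx m r)


def pat (m : M5) : Bool := Nat.beq m.e 0 && (!(Nat.beq m.a 0) && (!(Nat.beq m.b 0) &&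
  (Nat.beq m.d 0 || !(Nat.beq m.c 0))))

theorem kill_pat : upTo9 (fun m => !(pat m) || Nat.beq (xo (full m)) 0) = true := by
  decide +kernel

theorem chkE_all : at10 (fun m => !(isW m) || chkE m) = true := by decide +kernel

theorem chkR_all : at10 (fun m => !(isW m) || chkR m) = true := by decide +kernel

theorem invs_W : ∀ k : Fin 4, (invs k).all (fun m => isW m && (isW (sw 0 m) && (isW (sw 1 m) &&
    (isW (sw 2 m) && isW (sw 3 m))))) = true := by decide +kernel

theorem invs_inv : ∀ k t : Fin 4,
    (nrm (invs k ++ ((invs k).map (sw t)).flatMap eL)).isEmpty = true := by decide +kernel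

theorem invs_pv : ∀ k t : Fin 4, (xo (invs k)).testBit (pv t) = decide (k = t) := by
  decide +kernel

theorem val_pat {m : M5} (h : pat m = false) : val m = 0 := by
  have hab : Nat.beq (m.a * m.b) 0 = (Nat.beq m.a 0 || Nat.beq m.b 0) := by
    rw [Bool.eq_iff_iff]; simp only [Bool.or_eq_true, Nat.beq_eq, Nat.mul_eq_zero]
  rw [val, val0, hab]
  rw [pat] at h
  generalize look tab2 m = t2 at *
  generalize look tab3 m = t3 at *
  generalize look tab4 m = t4 at *
  generalize Nat.beq m.deg 10 = x at *
  generalize Nat.beq m.a 0 = xa at *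
  generalize Nat.beq m.b 0 = xb at *
  generalize Nat.beq m.c 0 = xc at *
  generalize Nat.beq m.d 0 = xd at *
  generalize Nat.beq m.e 0 = xe at *
  cases x <;> cases xa <;> cases xb <;> cases xc <;> cases xd <;> cases xe <;>
    first | rfl | exact absurd h (by decide)

theorem s1_zero : ∀ a, a ≤ 9 → ∀ k ∈ s1 a, Nat.beq k 0 = Nat.beq a 0 := by decide +kernel

theorem pat_full {m z : M5} (hm : m.small) (hz : z ∈ full m) : pat z = pat m := by
  obtain ⟨ha, hb, hc, hd, he⟩ := hm
  simp only [full, List.mem_flatMap, List.mem_map] at hz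
  obtain ⟨a, h1, b, h2, c, h3, d, h4, e, h5, rfl⟩ := hz
  simp only [pat, s1_zero _ ha _ h1, s1_zero _ hb _ h2, s1_zero _ hc _ h3, s1_zero _ hd _ h4,
    s1_zero _ he _ h5]

theorem xo_zero {L : List M5} (h : ∀ z ∈ L, val z = 0) : xo L = 0 := by
  induction L with
  | nil => rfl
  | cons x L ih =>
    rw [xo, h x (by simp), ih fun z hz => h z (by simp [hz])]; rfl

theorem kill (m : M5) (hm : m.deg ≤ 9) : xo (full m) = 0 := by
  have h := upTo9_spec kill_pat m hm
  cases hp : pat m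
  · exact xo_zero fun z hz => val_pat (by rw [pat_full (small_of_deg hm) hz, hp])
  · simpa [hp] using h

/-! functionals -/

def b2z (b : Bool) : ZMod 2 := bif b then 1 else 0

theorem b2z_xor (x y : Bool) : b2z (x ^^ y) = b2z x + b2z y := by
  cases x <;> cases y <;> decide

def phi (i : ℕ) : P 5 →ₗ[ZMod 2] ZMod 2 :=
  (basisMonomials (Fin 5) (ZMod 2)).constr (ZMod 2) fun a => b2z ((val (ofF a)).testBit i)

theorem phi_mono (i : ℕ) (m : M5) : phi i (mono m) = b2z ((val m).testBit i) := by
  have := (basisMonomials (Fin 5) (ZMod 2)).constr_basis (ZMod 2)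
    (fun a => b2z ((val (ofF a)).testBit i)) m.toF
  rw [coe_basisMonomials, ofF_toF] at this
  exact this

theorem phi_tp (i : ℕ) (L : List M5) : phi i (tp L) = b2z ((xo L).testBit i) := by
  induction L with
  | nil => simp [xo, b2z]
  | cons x L ih =>
    rw [tp_cons, map_add, ih, phi_mono, xo, ← b2z_xor]
    congr 1
    exact (Nat.testBit_xor ..).symm

theorem xo_filter (L : List M5) : xo (L.filter fun m => Nat.beq m.deg 10) = xo L := by
  induction L with
  | nil => rfl
  | cons x L ih =>
    rw [List.filter_cons]
    cases h : Nat.beq x.deg 10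
    · simp only [Bool.false_eq_true, if_false, ih, xo, val, h, cond_false]
      exact (Nat.zero_xor _).symm
    · simp only [if_true, xo, ih]

theorem hc_induct {q : P 5 → Prop} (d : ℕ) (h : P 5) (h0 : q 0) (ha : ∀ x y, q x → q y → q (x + y))
    (hs : ∀ (c : ZMod 2) x, q x → q (c • x)) (hm : ∀ m : M5, m.deg = d → q (mono m)) :
    q (homogeneousComponent d h) := by
  rw [homogeneousComponent_apply]
  apply Finset.sum_induction _ q ha h0
  intro a hx
  have : monomial a (coeff a h) = coeff a h • mono (ofF a) := by
    rw [mono, toF_ofF, smul_monomial, smul_eq_mul, mul_one]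
  rw [this]
  apply hs
  apply hm
  have h2 := (Finset.mem_filter.1 hx).2
  rw [Finsupp.degree_eq_sum] at h2
  rw [← h2]
  simp [Fin.sum_univ_five, ofF, M5.deg]; ring

theorem phi_hc (i n : ℕ) (hn : n ≠ 10) (p : P 5) : phi i (homogeneousComponent n p) = 0 := by
  apply hc_induct (q := fun x => phi i x = 0) n p
  · simp
  · intro x y hx hy; rw [map_add, hx, hy, add_zero]
  · intro c x hx; rw [map_smul, hx, smul_zero]
  · intro m hm
    rw [phi_mono, val]
    have : Nat.beq m.deg 10 = false := by
      rw [hm, Bool.eq_false_iff]; intro h; exact hn (Nat.eq_of_beq_eq_true h)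
    simp [this, b2z]

theorem phi_hit (i : ℕ) {p : P 5} (hp : p ∈ hitS 5) : phi i p = 0 := by
  have : hitS 5 ≤ LinearMap.ker (phi i) := by
    refine Submodule.span_le.2 ?_
    rintro _ ⟨j, hj, h, rfl⟩
    show phi i _ = 0
    rw [SqK, map_sum]
    apply Finset.sum_eq_zero
    intro d _
    by_cases hd : d + j = 10
    · apply hc_induct (q := fun x => phi i (homogeneousComponent (d + j) (sqTot 5 x)) = 0) d h
      · simp
      · intro x y hx hy; simp only [map_add, hx, hy, add_zero]
      · intro c x hx; simp only [map_smul, hx, smul_zero]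
      · intro m hm
        have h9 : m.deg ≤ 9 := by omega
        rw [sqTot_mono m (small_of_deg h9), hc_tp, hd, phi_tp, xo_filter, kill m h9]
        simp [b2z]
    · exact phi_hc _ _ hd _
  exact this hp

/-! the space of weight (2,2,1) -/

theorem isW_deg {m : M5} (h : isW m = true) : m.deg = 10 := by
  simp only [isW, Bool.and_eq_true, Nat.beq_eq] at h
  exact h.1

def Wsp : Submodule (ZMod 2) (P 5) := Submodule.span (ZMod 2) {p | ∃ m, isW m = true ∧ p = mono m}

theorem isW_iff (m : M5) :
    isW m = true ↔ mdeg m.toF = 10 ∧ (∃ j, m.toF j = 0) ∧ wt m.toF = w221 := by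
  obtain ⟨a, b, c, d, e⟩ := m
  have hw : ∀ i, wt (M5.toF ⟨a, b, c, d, e⟩) i =
      a / 2 ^ i % 2 + b / 2 ^ i % 2 + c / 2 ^ i % 2 + d / 2 ^ i % 2 + e / 2 ^ i % 2 := by
    intro i; simp [wt, Fin.sum_univ_five, M5.toF, ev]
  have hd : mdeg (M5.toF ⟨a, b, c, d, e⟩) = a + b + c + d + e := by
    simp [mdeg, Fin.sum_univ_five, M5.toF, ev]
  have hz : (∃ j, (M5.toF ⟨a, b, c, d, e⟩) j = 0) ↔ (a = 0 ∨ b = 0 ∨ c = 0 ∨ d = 0 ∨ e = 0) := by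
    simp [Fin.exists_fin_succ, M5.toF, ev]
  rw [hz, hd]
  simp only [isW, Bool.and_eq_true, Bool.or_eq_true, Nat.beq_eq, Nat.ble_eq, M5.deg]
  constructor
  · rintro ⟨h0, h1, h2, h3, ⟨h4, h5, h6, h7, h8⟩, h9⟩
    refine ⟨by clear h1 h2 h3 h9 hz hw; omega, h9, ?_⟩
    funext i
    rw [hw]
    rcases i with _ | _ | _ | i
    · simp only [Nat.pow_zero, Nat.div_one]
      exact h1
    · exact h2
    · exact h3
    · have hp : 8 ≤ 2 ^ (i + 1 + 1 + 1) := by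
        rw [show (8 : ℕ) = 2 ^ 3 by norm_num]
        exact Nat.pow_le_pow_right (by norm_num) (by omega)
      generalize 2 ^ (i + 1 + 1 + 1) = n at *
      have hl : ∀ x, x ≤ 7 → x / n % 2 = 0 := fun x hx => by
        rw [Nat.div_eq_of_lt (lt_of_lt_of_le (Nat.lt_succ_of_le hx) hp)]
      rw [hl a h4, hl b h5, hl c h6, hl d h7, hl e h8]
      rfl
  · rintro ⟨h0, h9, h⟩
    have e0 := congrFun h 0
    have e1 := congrFun h 1
    have e2 := congrFun h 2
    have e3 := congrFun h 3
    rw [hw] at e0 e1 e2 e3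
    rw [Nat.pow_zero] at e0
    simp only [Nat.div_one] at e0
    have hl : ∀ x, x ≤ 10 → x / 8 % 2 ≤ 0 → x ≤ 7 := fun x h1 h2 => by omega
    have e4 : a / 8 % 2 + b / 8 % 2 + c / 8 % 2 + d / 8 % 2 + e / 8 % 2 = 0 := e3
    clear hw hd hz h
    refine ⟨by clear e0 e1 e2 e3 e4 h9; omega, e0, e1, e2,
      ⟨hl a ?_ ?_, hl b ?_ ?_, hl c ?_ ?_, hl d ?_ ?_, hl e ?_ ?_⟩, h9⟩
    all_goals clear e0 e1 e2 e3 h9 hl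
    all_goals
      generalize a / 8 % 2 = a1 at *
      generalize b / 8 % 2 = b1 at *
      generalize c / 8 % 2 = c1 at *
      generalize d / 8 % 2 = d1 at *
      generalize e / 8 % 2 = f1 at *
      omega

theorem V15_eq : V15 = Wsp.map (hitS 5).mkQ := by
  rw [V15, Wsp, Submodule.map_span]
  congr 1
  ext q
  constructor
  · rintro ⟨a, h1, h2, h3, rfl⟩
    refine ⟨mono (ofF a), ⟨ofF a, ?_, rfl⟩, ?_⟩
    · rw [isW_iff, toF_ofF]; exact ⟨h1, h2, h3⟩
    · rw [mono, toF_ofF]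
  · rintro ⟨_, ⟨m, hm, rfl⟩, rfl⟩
    obtain ⟨h1, h2, h3⟩ := (isW_iff m).1 hm
    exact ⟨m.toF, h1, h2, h3, rfl⟩

theorem W_E {m : M5} (hm : isW m = true) : mono m + tp (eL m) ∈ hitS 5 := by
  have h := at10_spec chkE_all m (isW_deg hm)
  simp only [hm, Bool.not_true, Bool.false_or, chkE, Bool.and_eq_true] at h
  obtain ⟨h1, h2⟩ := h
  have h3 := tp_zero h1
  rw [tp_cons, tp_append, ← add_assoc] at h3
  rw [CharTwo.add_eq_zero.1 h3, tp_flatMap]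
  apply list_sum_mem
  intro x hx
  obtain ⟨z, hz, rfl⟩ := List.mem_map.1 hx
  rw [List.all_eq_true] at h2
  exact sqL_hit z (Nat.le_of_ble_eq_true (h2 z hz))

def eF (f : P 5) : P 5 := (wds.map fun x => (x.bas.map fun y =>
  phi y.1 (Rw x.w f) • mono (act x.w.reverse y.2)).sum).sum

theorem eF_mono (m : M5) : eF (mono m) = tp (eL m) := by
  rw [eF, eL, tp_flatMap]
  congr 1
  apply List.map_congr_left
  intro x _
  rw [Rw_mono]
  have key : (x.bas.map fun y => phi y.1 (mono (act x.w m)) • mono (act x.w.reverse y.2)).sum =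
      tp (x.bas.flatMap fun y =>
        bif (val (act x.w m)).testBit y.1 then [act x.w.reverse y.2] else []) := by
    rw [tp_flatMap]
    congr 1
    apply List.map_congr_left
    intro y _
    rw [phi_mono]
    cases (val (act x.w m)).testBit y.1 <;> simp [b2z]
  rw [key]
  cases h : Nat.beq (val (act x.w m)) 0
  · rfl
  · rw [Nat.beq_eq] at h
    simp [h]
    induction x.bas with
    | nil => rfl
    | cons y L ih => simpa using ih

theorem eF_add (f g : P 5) : eF (f + g) = eF f + eF g := by
  simp only [eF, map_add, add_smul, List.sum_map_add]

theorem eF_smul (c : ZMod 2) (f : P 5) : eF (c • f) = c • eF f := by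
  simp only [eF, map_smul, smul_assoc, List.smul_sum, List.map_map, Function.comp_def]

theorem eF_hit {f : P 5} (hf : f ∈ Wsp) : f + eF f ∈ hitS 5 := by
  induction hf using Submodule.span_induction with
  | mem x h => obtain ⟨m, hm, rfl⟩ := h; rw [eF_mono]; exact W_E hm
  | zero =>
    have : eF 0 = 0 := by simpa using eF_smul 0 0
    rw [this, add_zero]; exact zero_mem _
  | add x y _ _ hx hy =>
    rw [eF_add, add_add_add_comm]; exact add_mem hx hy
  | smul c x _ hx => rw [eF_smul, ← smul_add]; exact Submodule.smul_mem _ _ hx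

def ls (f : P 5) : List (ℕ × List (Fin 4)) → ZMod 2
  | [] => 0
  | t :: L => phi t.1 (Rw t.2 f) + ls f L

theorem ls_mono (m : M5) (L : List (ℕ × List (Fin 4))) : ls (mono m) L = b2z (bx m L) := by
  induction L with
  | nil => rfl
  | cons t L ih => rw [ls, ih, Rw_mono, phi_mono, bx, b2z_xor]

theorem ls_add (f g : P 5) (L : List (ℕ × List (Fin 4))) : ls (f + g) L = ls f L + ls g L := by
  induction L with
  | nil => simp [ls]
  | cons t L ih => simp only [ls, ih, map_add]; ring

theorem ls_smul (c : ZMod 2) (f : P 5) (L : List (ℕ × List (Fin 4))) :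
    ls (c • f) L = c * ls f L := by
  induction L with
  | nil => simp [ls]
  | cons t L ih => simp only [ls, ih, map_smul, smul_eq_mul]; ring

theorem ls_rels {f : P 5} (hf : f ∈ Wsp) {r : List (ℕ × List (Fin 4))} (hr : r ∈ rels) :
    ls f r = 0 := by
  induction hf using Submodule.span_induction with
  | mem x h =>
    obtain ⟨m, hm, rfl⟩ := h
    have h := at10_spec chkR_all m (isW_deg hm)
    simp only [hm, Bool.not_true, Bool.false_or, chkR, List.all_eq_true] at h
    have := h r hr
    rw [Bool.not_eq_true'] at this
    rw [ls_mono, this]; rfl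
  | zero => simpa using ls_smul 0 0 r
  | add x y _ _ hx hy => rw [ls_add, hx, hy, add_zero]
  | smul c x _ hx => rw [ls_smul, hx, mul_zero]

theorem phi_Rw {f : P 5} (hi : ∀ k, R k f + f ∈ hitS 5) (i : ℕ) (w : List (Fin 4)) :
    phi i (Rw w f) = phi i f := by
  have : ∀ w : List (Fin 4), Rw w f + f ∈ hitS 5 := by
    intro w
    induction w with
    | nil => simp only [Rw, LinearMap.id_apply, add_self']; exact zero_mem _
    | cons k w ih =>
      have h1 := add_mem (hit_Rw w (hi k)) ih
      rw [map_add, add_assoc, ← add_assoc (Rw w f), add_self', zero_add] at h1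
      exact h1
  have h := phi_hit i (this w)
  rw [map_add] at h
  exact CharTwo.add_eq_zero.1 h

set_option maxHeartbeats 1000000 in
theorem coords_zero {f : P 5} (hf : f ∈ Wsp) (hi : ∀ k, R k f + f ∈ hitS 5)
    (hp : ∀ k, phi (pv k) f = 0) : ∀ i < 22, phi i f = 0 := by
  have h0 := hp 0
  have h1 := hp 1
  have h2 := hp 2
  have h3 := hp 3
  simp only [pv] at h0 h1 h2 h3
  have hr := fun r hr => ls_rels hf (r := r) hr
  have c2 : ∀ x : ZMod 2, x + x = 0 := by decide
  simp only [rels, List.forall_mem_cons, ls, phi_Rw hi, h0, h1, h2, h3, add_zero, zero_add,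
    c2] at hr
  obtain ⟨g1, g3, g5, g6, g7, g8, g9, g11, g12, g13, g14, g15, g16, g17, g18, g19, g20, g21, -⟩ := hr
  intro i hi
  interval_cases i
  · exact h0
  · exact g1
  · exact h1
  · exact g3
  · exact h2
  · exact g5
  · exact g6
  · exact g7
  · exact g8
  · exact g9
  · exact h3
  · exact g11
  · exact g12
  · exact g13
  · exact g14
  · exact g15
  · exact g16
  · exact g17
  · exact g18
  · exact g19
  · exact g20
  · exact g21

theorem bas_lt : ∀ x ∈ wds, ∀ y ∈ x.bas, y.1 < 22 := by decide +kernel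

theorem W_zero {f : P 5} (hf : f ∈ Wsp) (hi : ∀ k, R k f + f ∈ hitS 5)
    (hp : ∀ k, phi (pv k) f = 0) : f ∈ hitS 5 := by
  have hc := coords_zero hf hi hp
  have h := eF_hit hf
  have : eF f = 0 := by
    rw [eF]
    apply List.sum_eq_zero
    intro z hz
    obtain ⟨x, hx, rfl⟩ := List.mem_map.1 hz
    apply List.sum_eq_zero
    intro z hz
    obtain ⟨y, hy, rfl⟩ := List.mem_map.1 hz
    rw [phi_Rw hi, hc _ (bas_lt x hx y hy), zero_smul]
  rwa [this, add_zero] at h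

/-! the four invariants -/

theorem mkQ_eq {p q : P 5} : (hitS 5).mkQ p = (hitS 5).mkQ q ↔ p + q ∈ hitS 5 := by
  rw [Submodule.mkQ_apply, Submodule.mkQ_apply, Submodule.Quotient.eq, CharTwo.sub_eq_add]

theorem invs_mem_W (k : Fin 4) : ∀ m ∈ invs k, isW m = true ∧ ∀ t, isW (sw t m) = true := by
  intro m hm
  have h := invs_W k
  rw [List.all_eq_true] at h
  have := h m hm
  simp only [Bool.and_eq_true] at this
  obtain ⟨h, h0, h1, h2, h3⟩ := this
  refine ⟨h, fun t => ?_⟩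
  fin_cases t <;> assumption

theorem invs_R (k t : Fin 4) : R t (tp (invs k)) + tp (invs k) ∈ hitS 5 := by
  have h := tp_zero (invs_inv k t)
  rw [tp_append] at h
  rw [R_tp, CharTwo.add_eq_zero.1 h, tp_flatMap, tp, ← List.sum_map_add]
  apply list_sum_mem
  intro x hx
  obtain ⟨z, hz, rfl⟩ := List.mem_map.1 hx
  obtain ⟨m, hm, rfl⟩ := List.mem_map.1 hz
  exact W_E ((invs_mem_W k m hm).2 t)

theorem rename_all {f : P 5} (hi : ∀ k, R k f + f ∈ hitS 5) (σ : Equiv.Perm (Fin 5)) :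
    rename σ f + f ∈ hitS 5 := by
  have hσ : σ ∈ Submonoid.closure (Set.range fun i : Fin 4 => Equiv.swap i.castSucc i.succ) := by
    rw [Equiv.Perm.mclosure_swap_castSucc_succ]; trivial
  induction hσ using Submonoid.closure_induction with
  | mem x h => obtain ⟨k, rfl⟩ := h; exact hi k
  | one =>
    have : rename (⇑(1 : Equiv.Perm (Fin 5))) f = f := by
      rw [Equiv.Perm.coe_one]; exact rename_id_apply f
    rw [this, add_self']; exact zero_mem _
  | mul x y _ _ hx hy =>
    have h1 := add_mem (hit_rename x hy) hx
    rw [map_add, add_assoc, ← add_assoc (rename x f), add_self', zero_add, rename_rename] at h1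
    exact h1

theorem invs_inWsp (k : Fin 4) : tp (invs k) ∈ Wsp := by
  apply list_sum_mem
  intro x hx
  obtain ⟨m, hm, rfl⟩ := List.mem_map.1 hx
  exact Submodule.subset_span ⟨m, (invs_mem_W k m hm).1, rfl⟩

def qk (k : Fin 4) : invSub V15 :=
  ⟨(hitS 5).mkQ (tp (invs k)), by
    refine ⟨?_, tp (invs k), rfl, fun σ => ?_⟩
    · rw [V15_eq]; exact Submodule.mem_map_of_mem (invs_inWsp k)
    · rw [mkQ_eq]; exact rename_all (invs_R k) σ⟩

def phiQ (i : ℕ) : (P 5 ⧸ hitS 5) →ₗ[ZMod 2] ZMod 2 :=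
  (hitS 5).liftQ (phi i) fun _ hp => phi_hit i hp

def lam : invSub V15 →ₗ[ZMod 2] (Fin 4 → ZMod 2) :=
  LinearMap.pi fun k => phiQ (pv k) ∘ₗ (invSub V15).subtype

theorem lam_qk (k t : Fin 4) : lam (qk k) t = if k = t then 1 else 0 := by
  have : lam (qk k) t = phi (pv t) (tp (invs k)) := rfl
  rw [this, phi_tp, invs_pv]
  by_cases h : k = t <;> simp [h, b2z]

theorem lam_surj : Function.Surjective lam := by
  intro v
  refine ⟨∑ k, v k • qk k, ?_⟩
  ext t
  simp [lam_qk]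

theorem lam_inj : Function.Injective lam := by
  rw [← LinearMap.ker_eq_bot, LinearMap.ker_eq_bot']
  rintro ⟨q, hq⟩ h0
  obtain ⟨hV, g, hg, hgi⟩ := id hq
  rw [V15_eq] at hV
  obtain ⟨f, hf, rfl⟩ := hV
  have hgf : g + f ∈ hitS 5 := mkQ_eq.1 hg
  have hi : ∀ k, R k f + f ∈ hitS 5 := by
    intro k
    have h1 : rename (gen k) g + f ∈ hitS 5 := mkQ_eq.1 (hgi (gen k))
    have h2 : R k g + R k f ∈ hitS 5 := by rw [← map_add]; exact hit_R k hgf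
    have h3 := add_mem h2 h1
    have e : R k g + R k f + (rename (gen k) g + f) = R k f + f + (R k g + R k g) := by
      show R k g + R k f + (R k g + f) = _
      ring
    rwa [e, add_self', add_zero] at h3
  have hp : ∀ k, phi (pv k) f = 0 := fun k => congrFun h0 k
  have := W_zero hf hi hp
  apply Subtype.ext
  exact (Submodule.Quotient.mk_eq_zero _).2 this

theorem stable (σ : Equiv.Perm (Fin 5)) (f : P 5) (hf : (hitS 5).mkQ f ∈ V15) :
    (hitS 5).mkQ (rename σ f) ∈ V15 := by
  rw [V15_eq] at hf
  obtain ⟨g, hg, hgf⟩ := hf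
  have h1 : rename σ g + rename σ f ∈ hitS 5 := by
    rw [← map_add]; exact hit_rename σ (mkQ_eq.1 hgf)
  rw [← mkQ_eq.2 h1]
  clear h1 hgf
  induction hg using Submodule.span_induction with
  | mem x h =>
    obtain ⟨m, hm, rfl⟩ := h
    obtain ⟨h1, ⟨j, h2⟩, h3⟩ := (isW_iff m).1 hm
    have hv : ∀ j, Finsupp.mapDomain σ m.toF j = m.toF (σ.symm j) := fun j =>
      Finsupp.mapDomain_equiv_apply _ _
    refine Submodule.subset_span ⟨Finsupp.mapDomain σ m.toF, ?_, ⟨σ j, ?_⟩, ?_, ?_⟩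
    · rw [← h1, mdeg, mdeg]
      simp only [hv]
      exact Equiv.sum_comp σ.symm _
    · rw [hv, Equiv.symm_apply_apply, h2]
    · rw [← h3]
      funext i
      simp only [wt, hv]
      exact Equiv.sum_comp σ.symm fun j => m.toF j / 2 ^ i % 2
    · rw [mono, rename_monomial]
  | zero => simp
  | add x y _ _ hx hy => rw [map_add, map_add]; exact add_mem hx hy
  | smul c x _ hx => rw [map_smul, map_smul]; exact Submodule.smul_mem _ _ hx

end S15

/-- `V15` is stable under the action of `Σ_5` and its `Σ_5`-invariant
subspace has dimension exactly 4. -/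
theorem statement15 :
    (∀ σ : Equiv.Perm (Fin 5), ∀ f : P 5,
        (hitS 5).mkQ f ∈ V15 → (hitS 5).mkQ (rename (⇑σ) f) ∈ V15) ∧
    Module.finrank (ZMod 2) ↥(invSub V15) = 4 := by
  refine ⟨S15.stable, ?_⟩
  rw [(LinearEquiv.ofBijective S15.lam ⟨S15.lam_inj, S15.lam_surj⟩).finrank_eq]
  simp
end
end

section
/- Let M ⊆ (QP_5)_{10} be the F_2-span of the classes of the ten monomials x_1x_2x_3^2x_4^2x_5^4, x_1x_2x_3^2x_4^4x_5^2, x_1x_2^2x_3x_4^2x_5^4, x_1x_2^2x_3x_4^4x_5^2, x_1x_2^2x_3^4x_4x_5^2, x_1x_2^2x_3^2x_4^2x_5^3, x_1x_2^2x_3^2x_4^3x_5^2, x_1x_2^2x_3^3x_4^2x_5^2, x_1x_2^3x_3^2x_4^2x_5^2, x_1^3x_2x_3^2x_4^2x_5^2. Then M is stable under the action of the group Σ_5 of variable permutations, and the Σ_5-invariant subspace of M is one-dimensional, spanned by the class of x_1x_2x_3^2x_4^4x_5^2 + x_1x_2^2x_3x_4^2x_5^4 + x_1x_2^2x_3x_4^4x_5^2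 + x_1x_2^2x_3^4x_4x_5^2. -/
open MvPolynomial

noncomputable section

/-- The span in `QP_5` of the classes of the ten listed monomials of degree 10. -/
def M16 : Submodule (ZMod 2) (P 5 ⧸ hitS 5) :=
  Submodule.span (ZMod 2)
    {q | ∃ v ∈ ([![1,1,2,2,4], ![1,1,2,4,2], ![1,2,1,2,4], ![1,2,1,4,2], ![1,2,4,1,2],
                 ![1,2,2,2,3], ![1,2,2,3,2], ![1,2,3,2,2], ![1,3,2,2,2], ![3,1,2,2,2]]
               : List (Fin 5 → ℕ)),
      q = (hitS 5).mkQ (monomial (ev v) 1)}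

/-- `p_5 = x_1x_2x_3^2x_4^4x_5^2 + x_1x_2^2x_3x_4^2x_5^4 + x_1x_2^2x_3x_4^4x_5^2
+ x_1x_2^2x_3^4x_4x_5^2`. -/
def p16 : P 5 :=
  monomial (ev ![1,1,2,4,2]) 1 + monomial (ev ![1,2,1,2,4]) 1
    + monomial (ev ![1,2,1,4,2]) 1 + monomial (ev ![1,2,4,1,2]) 1


namespace S16

abbrev mon (v : Fin 5 → ℕ) : P 5 := monomial (ev v) 1

/-- coefficient of `x^b` in `Sq(x^a)` -/
def cf (a b : Fin 5 → ℕ) : ℕ := ∏ i, if a i ≤ b i then (a i).choose (b i - a i) else 0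

lemma ev_apply (v : Fin 5 → ℕ) (i : Fin 5) : ev v i = v i := rfl

lemma ev_coe (a : Fin 5 →₀ ℕ) : ev (⇑a) = a := by
  ext i; rfl

lemma ev_inj {v w : Fin 5 → ℕ} : ev v = ev w ↔ v = w :=
  ⟨fun h => by funext i; have := DFunLike.congr_fun h i; simpa [ev_apply] using this,
   fun h => by rw [h]⟩

lemma deg_ev (v : Fin 5 → ℕ) : (ev v).degree = ∑ i, v i := by
  rw [Finsupp.degree_eq_sum]; rfl

lemma sqTot_mon (a : Fin 5 → ℕ) : sqTot 5 (mon a) =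
    ∑ e ∈ Fintype.piFinset (fun i => Finset.range (a i + 1)),
      monomial (ev fun i => a i + e i) ((∏ i, ((a i).choose (e i) : ZMod 2))) := by
  have h1 : mon a = ∏ i, (X i : P 5) ^ a i := by
    rw [mon, monomial_eq, Finsupp.prod_fintype]
    · simp [ev_apply]
    · intro i; simp
  have h2 : ∀ i : Fin 5, ((X i : P 5) + X i ^ 2) ^ a i =
      ∑ e ∈ Finset.range (a i + 1), C ((a i).choose e : ZMod 2) * X i ^ (a i + e) := by
    intro i
    have : (X i : P 5) + X i ^ 2 = X i * (X i + 1) := by ring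
    rw [this, mul_pow, add_pow, Finset.mul_sum]
    refine Finset.sum_congr rfl fun e _ => ?_
    simp only [one_pow, mul_one, map_natCast]
    ring
  rw [h1, map_prod]
  simp only [map_pow, sqTot, bind₁_X_right, h2]
  rw [Finset.prod_univ_sum]
  refine Finset.sum_congr rfl fun e _ => ?_
  rw [Finset.prod_mul_distrib, ← map_prod, monomial_eq, Finsupp.prod_fintype]
  · simp [ev_apply]
  · intro i; simp

lemma coeff_sqTot (a b : Fin 5 → ℕ) : coeff (ev b) (sqTot 5 (mon a)) = (cf a b : ZMod 2) := by
  rw [sqTot_mon, coeff_sum]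
  simp only [coeff_monomial, ev_inj]
  by_cases hab : ∀ i, a i ≤ b i
  · have hb : ∀ e : Fin 5 → ℕ, ((fun i => a i + e i) = b) ↔ e = fun i => b i - a i := by
      intro e
      constructor
      · intro h; funext i; have := congrFun h i; omega
      · intro h; funext i; rw [h]; have := hab i; simp only; omega
    simp only [hb]
    rw [Finset.sum_ite_eq']
    have hcf : (cf a b : ZMod 2) = ∏ i, ((a i).choose (b i - a i) : ZMod 2) := by
      rw [cf, Nat.cast_prod]
      exact Finset.prod_congr rfl fun i _ => by rw [if_pos (hab i)]
    rw [hcf]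
    split_ifs with hm
    · rfl
    · rw [Fintype.mem_piFinset] at hm
      push Not at hm
      obtain ⟨i, hi⟩ := hm
      rw [Finset.mem_range] at hi
      symm
      apply Finset.prod_eq_zero (Finset.mem_univ i)
      rw [Nat.choose_eq_zero_of_lt (by omega)]; simp
  · push Not at hab
    obtain ⟨i, hi⟩ := hab
    have : cf a b = 0 := Finset.prod_eq_zero (Finset.mem_univ i) (by rw [if_neg (by omega)])
    rw [this, Nat.cast_zero]
    refine Finset.sum_eq_zero fun e _ => ?_
    rw [if_neg]
    intro h; have := congrFun h i; omega

lemma hc_mon (d : ℕ) (a : Fin 5 → ℕ) :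
    homogeneousComponent d (mon a) = if ∑ i, a i = d then mon a else 0 := by
  rw [homogeneousComponent_of_mem (m := d) (isHomogeneous_monomial (1 : ZMod 2) (deg_ev a))]
  simp only [eq_comm]

lemma coeff_SqK (k : ℕ) (a b : Fin 5 → ℕ) (h : ∑ i, b i = ∑ i, a i + k) :
    coeff (ev b) (SqK 5 k (mon a)) = (cf a b : ZMod 2) := by
  have ht : (mon a).totalDegree = ∑ i, a i := by
    rw [mon, totalDegree_monomial _ one_ne_zero]
    exact deg_ev a
  rw [SqK, coeff_sum, ht, Finset.sum_eq_single (∑ i, a i)]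
  · rw [hc_mon, if_pos rfl, coeff_homogeneousComponent, deg_ev, if_pos h, coeff_sqTot]
  · intro d _ hd
    rw [hc_mon, if_neg (Ne.symm hd)]; simp
  · intro hn; exact absurd (Finset.mem_range.2 (Nat.lt_succ_self _)) hn

lemma coeff_SqK' (k : ℕ) (a b : Fin 5 → ℕ) (h : ∑ i, b i ≠ ∑ i, a i + k) :
    coeff (ev b) (SqK 5 k (mon a)) = 0 := by
  rw [SqK, coeff_sum]
  refine Finset.sum_eq_zero fun d _ => ?_
  rw [hc_mon]
  split_ifs with hd
  · rw [coeff_homogeneousComponent, deg_ev, if_neg (by rw [← hd]; exact h)]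
  · simp

lemma cf_zero {a b : Fin 5 → ℕ} (i : Fin 5) (h : a i = 0) (hb : b i ≠ 0) : cf a b = 0 := by
  refine Finset.prod_eq_zero (Finset.mem_univ i) ?_
  rw [h, if_pos (Nat.zero_le _), Nat.choose_eq_zero_of_lt (by omega)]

lemma cf_zero' {a b : Fin 5 → ℕ} (i : Fin 5) (h : a i ≠ 0) (hb : b i = 0) : cf a b = 0 := by
  refine Finset.prod_eq_zero (Finset.mem_univ i) ?_
  rw [hb, if_neg (by omega)]

/-! ### Certificates for hit polynomials -/

def okA (a : Fin 5 → ℕ) : Bool := decide ((∀ i, a i ≠ 0) ∧ ∑ i, a i < 10)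
def okT (a : Fin 5 → ℕ) : Bool := decide ((∀ i, a i ≠ 0) ∧ ∑ i, a i = 10)

def B10 : List (Fin 5 → ℕ) :=
  (List.Nat.antidiagonalTuple 5 5).map fun t i => t i + 1

lemma mem_B10 (b : Fin 5 → ℕ) (h0 : ∀ i, b i ≠ 0) (h : ∑ i, b i = 10) : b ∈ B10 := by
  refine List.mem_map.2 ⟨fun i => b i - 1, ?_, ?_⟩
  · rw [List.Nat.mem_antidiagonalTuple]
    simp only [Fin.sum_univ_five] at h ⊢
    have := h0 0; have := h0 1; have := h0 2; have := h0 3; have := h0 4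
    omega
  · funext i; have := h0 i; simp only; omega

def check (T A : List (Fin 5 → ℕ)) : Bool :=
  T.all okT && A.all okA &&
    B10.all fun b => (T.count b + (A.map fun a => cf a b).sum) % 2 == 0

lemma coeff_list (T : List (Fin 5 → ℕ)) (b : Fin 5 → ℕ) :
    coeff (ev b) (T.map mon).sum = (T.count b : ZMod 2) := by
  induction T with
  | nil => simp
  | cons v T ih =>
    rw [List.map_cons, List.sum_cons, coeff_add, ih, coeff_monomial, List.count_cons]
    simp only [ev_inj, beq_iff_eq]
    split_ifs <;> push_cast <;> ring

lemma coeff_listA (A : List (Fin 5 → ℕ)) (hA : ∀ a ∈ A, ∑ i, a i < 10) (b : Fin 5 → ℕ)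
    (hb : ∑ i, b i = 10) :
    coeff (ev b) (A.map fun a => SqK 5 (10 - ∑ i, a i) (mon a)).sum =
      (((A.map fun a => cf a b).sum : ℕ) : ZMod 2) := by
  induction A with
  | nil => simp
  | cons v T ih =>
    have hv := hA v List.mem_cons_self
    rw [List.map_cons, List.sum_cons, coeff_add, ih (fun a ha => hA a (List.mem_cons_of_mem _ ha)),
      coeff_SqK _ _ _ (by omega), List.map_cons, List.sum_cons, Nat.cast_add]

lemma coeff_listA0 (A : List (Fin 5 → ℕ)) (hA : ∀ a ∈ A, ∑ i, a i < 10) (b : Fin 5 → ℕ)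
    (hb : ∑ i, b i ≠ 10) :
    coeff (ev b) (A.map fun a => SqK 5 (10 - ∑ i, a i) (mon a)).sum = 0 := by
  induction A with
  | nil => simp
  | cons v T ih =>
    have hv := hA v List.mem_cons_self
    rw [List.map_cons, List.sum_cons, coeff_add, ih (fun a ha => hA a (List.mem_cons_of_mem _ ha)),
      coeff_SqK' _ _ _ (by omega), zero_add]

lemma hit_of_check (T A : List (Fin 5 → ℕ)) (h : check T A = true) :
    (T.map mon).sum ∈ hitS 5 := by
  simp only [check, Bool.and_eq_true, List.all_eq_true, okT, okA, decide_eq_true_eq,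
    beq_iff_eq] at h
  obtain ⟨⟨hT, hA⟩, hB⟩ := h
  have hA' : ∀ a ∈ A, ∑ i, a i < 10 := fun a ha => (hA a ha).2
  have key : (T.map mon).sum = (A.map fun a => SqK 5 (10 - ∑ i, a i) (mon a)).sum := by
    ext b
    rw [← ev_coe b]
    generalize (⇑b) = b
    rw [coeff_list]
    by_cases hb : ∑ i, b i = 10
    · rw [coeff_listA A hA' b hb]
      have h2 : ((T.count b + (A.map fun a => cf a b).sum : ℕ) : ZMod 2) = 0 := by
        rw [ZMod.natCast_eq_zero_iff]
        apply Nat.dvd_of_mod_eq_zero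
        by_cases h0 : ∀ i, b i ≠ 0
        · exact hB b (mem_B10 b h0 hb)
        · push Not at h0
          obtain ⟨i, hi⟩ := h0
          have c1 : T.count b = 0 := List.count_eq_zero.2 fun hm => (hT b hm).1 i hi
          have c2 : (A.map fun a => cf a b).sum = 0 := by
            rw [List.sum_eq_zero_iff]
            intro x hx
            obtain ⟨a, ha, rfl⟩ := List.mem_map.1 hx
            exact cf_zero' i ((hA a ha).1 i) hi
          rw [c1, c2]
      push_cast at h2
      rw [CharTwo.add_eq_zero] at h2
      push_cast
      exact h2
    · rw [coeff_listA0 A hA' b hb]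
      have c1 : T.count b = 0 := List.count_eq_zero.2 fun hm => hb (hT b hm).2
      rw [c1, Nat.cast_zero]
  rw [key]
  refine list_sum_mem fun x hx => ?_
  obtain ⟨a, ha, rfl⟩ := List.mem_map.1 hx
  exact Submodule.subset_span ⟨_, by have := hA' a ha; omega, _, rfl⟩

/-! ### Hit polynomials are stable under permutations -/

lemma rename_SqK (σ : Equiv.Perm (Fin 5)) (k : ℕ) (f : P 5) :
    rename (⇑σ) (SqK 5 k f) = SqK 5 k (rename (⇑σ) f) := by
  have hd : (rename (⇑σ) f).totalDegree = f.totalDegree := by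
    simpa using totalDegree_renameEquiv (R := ZMod 2) σ f
  rw [SqK, SqK, hd, map_sum]
  refine Finset.sum_congr rfl fun d _ => ?_
  have hs : ∀ g : P 5, rename (⇑σ) (sqTot 5 g) = sqTot 5 (rename (⇑σ) g) := by
    intro g
    unfold sqTot
    rw [rename_bind₁, bind₁_rename]
    congr 2
    funext i
    simp
  rw [rename_homogeneousComponent, hs, rename_homogeneousComponent]

lemma rename_hit (σ : Equiv.Perm (Fin 5)) {f : P 5} (hf : f ∈ hitS 5) :
    rename (⇑σ) f ∈ hitS 5 := by
  have : hitS 5 ≤ (hitS 5).comap (rename (R := ZMod 2) (⇑σ)).toLinearMap := by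
    rw [hitS, Submodule.span_le]
    rintro g ⟨j, hj, h, rfl⟩
    exact Submodule.subset_span ⟨j, hj, rename (⇑σ) h, rename_SqK σ j h⟩
  exact this hf

lemma mkQ_eq {f g : P 5} (h : f + g ∈ hitS 5) : (hitS 5).mkQ f = (hitS 5).mkQ g := by
  rw [Submodule.mkQ_apply, Submodule.mkQ_apply, Submodule.Quotient.eq, CharTwo.sub_eq_add]
  exact h

lemma mkQ_rename (σ : Equiv.Perm (Fin 5)) {f g : P 5} (h : (hitS 5).mkQ f = (hitS 5).mkQ g) :
    (hitS 5).mkQ (rename (⇑σ) f) = (hitS 5).mkQ (rename (⇑σ) g) := by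
  rw [Submodule.mkQ_apply, Submodule.mkQ_apply, Submodule.Quotient.eq] at h ⊢
  rw [← map_sub]
  exact rename_hit σ h

lemma rename_mon (σ : Equiv.Perm (Fin 5)) (v : Fin 5 → ℕ) :
    rename (⇑σ) (mon v) = mon (v ∘ ⇑σ.symm) := by
  rw [mon, rename_monomial]
  refine congrArg (fun s => monomial s (1 : ZMod 2)) (Finsupp.ext fun i => ?_)
  rw [← σ.apply_symm_apply i, Finsupp.mapDomain_apply σ.injective]
  simp [ev_apply]

/-! ### The linear functional -/

def L : List (Fin 5 → ℕ) := [![1,2,3,2,2], ![1,2,4,1,2], ![1,2,4,2,1], ![1,2,5,1,1], ![1,4,2,1,2], ![1,4,2,2,1], ![1,5,1,1,2], ![1,5,1,2,1], ![2,1,3,2,2], ![2,1,4,1,2], ![2,1,4,2,1], ![2,1,5,1,1], ![2,3,2,1,2], ![2,3,2,2,1], ![2,4,1,1,2], ![2,4,1,2,1], ![3,2,2,1,2], ![3,2,2,2,1], ![4,1,2,1,2], ![4,1,2,2,1], ![4,2,1,1,2], ![4,2,1,2,1], ![5,1,1,1,2], ![5,1,1,2,1]]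

def phi : P 5 →ₗ[ZMod 2] ZMod 2 := (L.map fun v => lcoeff (ZMod 2) (ev v)).sum

lemma phi_apply (f : P 5) : phi f = (L.map fun v => coeff (ev v) f).sum := by
  rw [phi]
  induction L with
  | nil => simp
  | cons v T ih => simp [ih, lcoeff_apply]

lemma L_ok : L.all okT = true := by decide +kernel

lemma L_check : ∀ n < 5, ((List.Nat.antidiagonalTuple 5 n).all fun t =>
    (L.map fun b => cf (fun i => t i + 1) b).sum % 2 == 0) = true := by decide +kernel

lemma L_nodup : L.Nodup := by decide +kernel

lemma cast_list_sum (l : List (Fin 5 → ℕ)) (g : (Fin 5 → ℕ) → ℕ) :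
    (l.map fun v => (g v : ZMod 2)).sum = (((l.map g).sum : ℕ) : ZMod 2) := by
  induction l with
  | nil => simp
  | cons v T ih => simp [ih]

lemma phi_mon_aux (a : Fin 5 → ℕ) (k : ℕ) (hk : 1 ≤ k) :
    phi (homogeneousComponent (∑ i, a i + k) (sqTot 5 (mon a))) = 0 := by
  have hL := L_ok
  simp only [List.all_eq_true, okT, decide_eq_true_eq] at hL
  rw [phi_apply]
  by_cases hd : ∑ i, a i + k = 10
  · have h1 : (L.map fun v => coeff (ev v) (homogeneousComponent (∑ i, a i + k)
        (sqTot 5 (mon a)))) = L.map fun v => (cf a v : ZMod 2) := by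
      refine List.map_congr_left fun v hv => ?_
      rw [coeff_homogeneousComponent, deg_ev, if_pos ((hL v hv).2.trans hd.symm), coeff_sqTot]
    rw [h1, cast_list_sum, ZMod.natCast_eq_zero_iff]
    apply Nat.dvd_of_mod_eq_zero
    by_cases h0 : ∀ i, a i ≠ 0
    · have hn : ∑ i, (a i - 1) < 5 := by
        simp only [Fin.sum_univ_five] at hd ⊢
        have := h0 0; have := h0 1; have := h0 2; have := h0 3; have := h0 4
        omega
      have := L_check _ hn
      simp only [List.all_eq_true, beq_iff_eq] at this
      have h3 := this (fun i => a i - 1) (List.Nat.mem_antidiagonalTuple.2 rfl)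
      have h4 : (fun i => a i - 1 + 1) = a := by funext i; have := h0 i; omega
      simp only [h4] at h3
      exact h3
    · push Not at h0
      obtain ⟨i, hi⟩ := h0
      have c2 : (L.map fun b => cf a b).sum = 0 := by
        rw [List.sum_eq_zero_iff]
        intro x hx
        obtain ⟨b, hb, rfl⟩ := List.mem_map.1 hx
        exact cf_zero i hi ((hL b hb).1 i)
      rw [c2]
  · apply List.sum_eq_zero
    intro x hx
    obtain ⟨v, hv, rfl⟩ := List.mem_map.1 hx
    rw [coeff_homogeneousComponent, deg_ev, if_neg (by rw [(hL v hv).2]; exact fun h => hd h.symm)]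

lemma phi_hit {f : P 5} (hf : f ∈ hitS 5) : phi f = 0 := by
  have : hitS 5 ≤ LinearMap.ker phi := by
    rw [hitS, Submodule.span_le]
    rintro g ⟨k, hk, h, rfl⟩
    rw [SetLike.mem_coe, LinearMap.mem_ker, SqK, map_sum]
    refine Finset.sum_eq_zero fun d _ => ?_
    rw [homogeneousComponent_apply d h, map_sum, map_sum, map_sum]
    refine Finset.sum_eq_zero fun a ha => ?_
    have hda : ∑ i, a i = d := by
      rw [← (Finset.mem_filter.1 ha).2, Finsupp.degree_eq_sum]
    have hm : monomial a (coeff a h) = coeff a h • mon (⇑a) := by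
      rw [mon, ev_coe, smul_monomial, smul_eq_mul, mul_one]
    rw [hm, map_smul, map_smul, map_smul, ← hda, phi_mon_aux _ _ hk, smul_zero]
  exact this hf

def val (v : Fin 5 → ℕ) : ZMod 2 := if v ∈ L then 1 else 0

lemma phi_mon (v : Fin 5 → ℕ) : phi (mon v) = val v := by
  rw [phi_apply]
  have : (L.map fun w => coeff (ev w) (mon v)) =
      L.map fun w => (((if v = w then 1 else 0 : ℕ)) : ZMod 2) := by
    refine List.map_congr_left fun w _ => ?_
    rw [coeff_monomial]
    simp only [ev_inj]
    push_cast
    rfl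
  rw [this, cast_list_sum]
  have h2 : (L.map fun w => if v = w then 1 else 0).sum = L.count v := by
    induction L with
    | nil => simp
    | cons w T ih =>
      rw [List.map_cons, List.sum_cons, ih, List.count_cons]
      simp only [beq_iff_eq, eq_comm (a := v)]
      omega
  rw [h2, val]
  split_ifs with h
  · rw [List.count_eq_one_of_mem L_nodup h]; simp
  · rw [List.count_eq_zero.2 h]; simp

lemma phi_mkQ {f g : P 5} (h : (hitS 5).mkQ f = (hitS 5).mkQ g) : phi f = phi g := by
  rw [Submodule.mkQ_apply, Submodule.mkQ_apply, Submodule.Quotient.eq] at h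
  rw [← sub_eq_zero, ← map_sub]
  exact phi_hit h

/-! ### Generators -/

def ten : List (Fin 5 → ℕ) :=
  [![1,1,2,2,4], ![1,1,2,4,2], ![1,2,1,2,4], ![1,2,1,4,2], ![1,2,4,1,2],
   ![1,2,2,2,3], ![1,2,2,3,2], ![1,2,3,2,2], ![1,3,2,2,2], ![3,1,2,2,2]]

def T (i : Fin 10) : Fin 5 → ℕ := ten.get i

def certs : List ((Fin 5 → ℕ) × List (Fin 5 → ℕ) × List (Fin 5 → ℕ)) := [
  (![1,1,4,2,2], [![1,1,2,2,4], ![1,1,2,4,2]],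
    [![1,1,2,2,2], ![2,2,1,2,2]]),
  (![1,2,2,1,4], [![1,1,2,2,4], ![1,2,1,2,4]],
    [![1,1,1,1,4], ![2,1,1,1,4]]),
  (![1,2,4,2,1], [![1,1,2,2,4], ![1,1,2,4,2], ![1,2,4,1,2]],
    [![1,1,2,1,1], ![1,1,2,2,2], ![2,1,4,1,1]]),
  (![1,4,2,1,2], [![1,1,2,2,4], ![1,2,1,2,4], ![1,2,4,1,2]],
    [![1,1,1,1,2], ![1,2,2,1,2], ![2,1,1,1,4]]),
  (![2,1,1,2,4], [![1,1,2,2,4], ![1,2,1,2,4]],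
    [![1,1,1,2,4]]),
  (![2,1,1,4,2], [![1,1,2,4,2], ![1,2,1,4,2]],
    [![1,1,1,4,2]]),
  (![2,1,2,2,3], [![1,1,2,2,4], ![1,2,2,2,3]],
    [![1,1,2,2,3]]),
  (![2,1,2,3,2], [![1,1,2,4,2], ![1,2,2,3,2]],
    [![1,1,2,3,2]]),
  (![2,1,3,2,2], [![1,1,2,2,4], ![1,1,2,4,2], ![1,2,3,2,2]],
    [![1,1,1,1,1], ![1,1,2,2,2], ![1,1,3,2,2]]),
  (![2,1,4,1,2], [![1,1,2,2,4], ![1,1,2,4,2], ![1,2,4,1,2]],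
    [![1,1,2,2,2], ![1,1,4,1,2], ![2,2,1,2,2]]),
  (![3,2,1,2,2], [![1,1,2,2,4], ![1,1,2,4,2], ![1,2,1,2,4], ![1,2,1,4,2], ![3,1,2,2,2]],
    [![1,1,1,2,2], ![2,1,1,2,2], ![3,1,1,2,2]])]

lemma certs_ok : (certs.all fun c => c.2.1.all (fun v => decide (v ∈ ten)) &&
    check (c.1 :: c.2.1) c.2.2) = true := by decide +kernel

lemma mem_M {v : Fin 5 → ℕ} (h : v ∈ ten) : (hitS 5).mkQ (mon v) ∈ M16 :=
  Submodule.subset_span ⟨v, h, rfl⟩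

lemma mem_M_list (l : List (Fin 5 → ℕ)) (h : ∀ v ∈ l, v ∈ ten) :
    (hitS 5).mkQ (l.map mon).sum ∈ M16 := by
  induction l with
  | nil => simp
  | cons v l ih =>
    rw [List.map_cons, List.sum_cons, map_add]
    exact M16.add_mem (mem_M (h v List.mem_cons_self))
      (ih fun w hw => h w (List.mem_cons_of_mem _ hw))

lemma mem_M_cert {v : Fin 5 → ℕ} (h : v ∈ certs.map (·.1)) : (hitS 5).mkQ (mon v) ∈ M16 := by
  obtain ⟨c, hc, rfl⟩ := List.mem_map.1 h
  have := List.all_eq_true.1 certs_ok c hc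
  rw [Bool.and_eq_true] at this
  obtain ⟨h1, h2⟩ := this
  have h3 := hit_of_check _ _ h2
  rw [List.map_cons, List.sum_cons] at h3
  rw [mkQ_eq h3]
  exact mem_M_list _ (by simpa using h1)

lemma swap_mem : ∀ i : Fin 4, ∀ v ∈ ten,
    (v ∘ ⇑(Equiv.swap i.castSucc i.succ).symm) ∈ ten ++ certs.map (·.1) := by decide +kernel

lemma stable_of_mon (σ : Equiv.Perm (Fin 5))
    (h : ∀ v ∈ ten, (hitS 5).mkQ (rename (⇑σ) (mon v)) ∈ M16) (f : P 5)
    (hf : (hitS 5).mkQ f ∈ M16) : (hitS 5).mkQ (rename (⇑σ) f) ∈ M16 := by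
  have hle : hitS 5 ≤ (hitS 5).comap (rename (R := ZMod 2) (⇑σ)).toLinearMap :=
    fun x hx => rename_hit σ hx
  have : M16 ≤ M16.comap ((hitS 5).mapQ (hitS 5) (rename (R := ZMod 2) (⇑σ)).toLinearMap hle) := by
    conv_lhs => rw [M16]
    rw [Submodule.span_le]
    rintro q ⟨v, hv, rfl⟩
    exact h v hv
  exact this hf

lemma perm_induct (Q : Equiv.Perm (Fin 5) → Prop) (h1 : Q 1)
    (hs : ∀ i : Fin 4, Q (Equiv.swap i.castSucc i.succ))
    (hm : ∀ σ τ, Q σ → Q τ → Q (σ * τ)) (σ : Equiv.Perm (Fin 5)) : Q σ := by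
  have : σ ∈ Submonoid.closure (Set.range fun i : Fin 4 ↦ Equiv.swap i.castSucc i.succ) := by
    rw [Equiv.Perm.mclosure_swap_castSucc_succ]; trivial
  induction this using Submonoid.closure_induction with
  | mem x hx => obtain ⟨i, rfl⟩ := hx; exact hs i
  | one => exact h1
  | mul x y _ _ hx hy => exact hm x y hx hy

lemma rename_mul (σ τ : Equiv.Perm (Fin 5)) (f : P 5) :
    rename (⇑(σ * τ)) f = rename (⇑σ) (rename (⇑τ) f) := by
  rw [rename_rename]; rfl

lemma stable (σ : Equiv.Perm (Fin 5)) : ∀ f : P 5,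
    (hitS 5).mkQ f ∈ M16 → (hitS 5).mkQ (rename (⇑σ) f) ∈ M16 := by
  induction σ using perm_induct with
  | h1 => intro f hf; simpa using hf
  | hs i =>
    apply stable_of_mon
    intro v hv
    rw [rename_mon]
    rcases List.mem_append.1 (swap_mem i v hv) with h | h
    · exact mem_M h
    · exact mem_M_cert h
  | hm σ τ hσ hτ =>
    intro f hf
    rw [rename_mul]
    exact hσ _ (hτ _ hf)

/-! ### Invariance of `p16` -/

def pl : List (Fin 5 → ℕ) := [![1,1,2,4,2], ![1,2,1,2,4], ![1,2,1,4,2], ![1,2,4,1,2]]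

lemma p16_eq : p16 = (pl.map mon).sum := by
  simp only [p16, pl, List.map_cons, List.map_nil, List.sum_cons, List.sum_nil, mon]
  ring

def pcert : Fin 4 → List (Fin 5 → ℕ) :=
  ![[![1,1,1,2,2], ![1,1,2,2,2], ![1,1,4,1,2]],
    [![1,1,1,1,2], ![1,2,2,1,2], ![2,1,1,1,4]],
    [![1,1,1,1,2], ![1,1,2,2,2], ![2,1,1,1,4]],
    [![1,1,2,1,1], ![1,1,2,2,2], ![2,1,4,1,1]]]

lemma pcert_ok : ∀ i : Fin 4,
    check ((pl.map fun v => v ∘ ⇑(Equiv.swap i.castSucc i.succ).symm) ++ pl) (pcert i) = true := by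
  decide +kernel

lemma p16_inv (σ : Equiv.Perm (Fin 5)) :
    (hitS 5).mkQ (rename (⇑σ) p16) = (hitS 5).mkQ p16 := by
  induction σ using perm_induct with
  | h1 => simp
  | hs i =>
    apply mkQ_eq
    have := hit_of_check _ _ (pcert_ok i)
    rw [List.map_append, List.sum_append, ← p16_eq] at this
    convert this using 2
    rw [p16_eq, map_list_sum, List.map_map, List.map_map]
    congr 1
    refine List.map_congr_left fun v _ => ?_
    exact rename_mon _ v
  | hm σ τ hσ hτ => rw [rename_mul, mkQ_rename σ hτ, hσ]

/-! ### Solving for the invariants -/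

def sg : Fin 9 → Equiv.Perm (Fin 5)
 | 0 => ⟨![0,1,3,2,4], ![0,1,3,2,4], by decide, by decide⟩
 | 1 => ⟨![0,1,3,4,2], ![0,1,4,2,3], by decide, by decide⟩
 | 2 => ⟨![0,2,1,3,4], ![0,2,1,3,4], by decide, by decide⟩
 | 3 => ⟨![0,3,1,2,4], ![0,2,3,1,4], by decide, by decide⟩
 | 4 => ⟨![0,3,1,4,2], ![0,2,4,1,3], by decide, by decide⟩
 | 5 => ⟨![0,2,3,1,4], ![0,3,1,2,4], by decide, by decide⟩
 | 6 => ⟨![0,3,4,1,2], ![0,3,4,1,2], by decide, by decide⟩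
 | 7 => ⟨![0,2,3,4,1], ![0,4,1,2,3], by decide, by decide⟩
 | 8 => ⟨![2,0,1,3,4], ![1,2,0,3,4], by decide, by decide⟩
def W : Fin 9 → Fin 10 → ZMod 2 :=
  ![![0,0,0,1,1,0,1,1,0,0],
![0,0,1,0,1,1,0,1,0,0],
![0,0,0,0,0,0,0,1,1,0],
![0,1,0,0,1,0,1,1,0,1],
![1,0,0,0,0,1,0,1,0,1],
![0,0,0,1,1,0,0,1,1,0],
![1,1,1,1,1,1,0,1,0,1],
![0,0,1,0,1,0,0,1,1,0],
![0,0,0,0,0,0,0,1,0,1]]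

lemma W_eq : ∀ j i, val (T i ∘ ⇑(sg j).symm) - val (T i) = W j i := by decide +kernel

set_option synthInstance.maxSize 4000 in
set_option synthInstance.maxHeartbeats 400000 in
set_option maxSynthPendingDepth 20 in
lemma solve : ∀ c0 c1 c2 c3 c4 c5 c6 c7 c8 c9 : ZMod 2,
    (∀ j : Fin 9, c0 * W j 0 + c1 * W j 1 + c2 * W j 2 + c3 * W j 3 + c4 * W j 4 +
      c5 * W j 5 + c6 * W j 6 + c7 * W j 7 + c8 * W j 8 + c9 * W j 9 = 0) →
    c0 = 0 ∧ c2 = c1 ∧ c3 = c1 ∧ c4 = c1 ∧ c5 = 0 ∧ c6 = 0 ∧ c7 = 0 ∧ c8 = 0 ∧ c9 = 0 := by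
  decide +kernel

lemma M_rep {q : P 5 ⧸ hitS 5} (hq : q ∈ M16) :
    ∃ c : Fin 10 → ZMod 2, (hitS 5).mkQ (∑ i, c i • mon (T i)) = q := by
  have : M16 ≤ Submodule.span (ZMod 2) (Set.range fun i => (hitS 5).mkQ (mon (T i))) := by
    apply Submodule.span_mono
    rintro q ⟨v, hv, rfl⟩
    obtain ⟨i, rfl⟩ := List.mem_iff_get.1 (show v ∈ ten from hv)
    exact ⟨i, rfl⟩
  obtain ⟨c, hc⟩ := (Submodule.mem_span_range_iff_exists_fun _).1 (this hq)
  exact ⟨c, by rw [← hc]; simp only [map_sum, map_smul]⟩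

lemma inv_le : invSub M16 ≤ Submodule.span (ZMod 2) {(hitS 5).mkQ p16} := by
  rintro q ⟨hq, f, hf, hfs⟩
  obtain ⟨c, hc⟩ := M_rep hq
  have h1 : ∀ j : Fin 9, ∑ i, c i * W j i = 0 := by
    intro j
    have h2 := mkQ_rename (sg j) (hc.trans hf.symm)
    rw [hfs, ← hc] at h2
    have h3 := phi_mkQ h2
    rw [← sub_eq_zero] at h3
    simp only [map_sum, map_smul, rename_mon, phi_mon, smul_eq_mul] at h3
    rw [← Finset.sum_sub_distrib] at h3
    rw [← h3]
    exact Finset.sum_congr rfl fun i _ => by rw [← W_eq, mul_sub]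
  have h4 := solve (c 0) (c 1) (c 2) (c 3) (c 4) (c 5) (c 6) (c 7) (c 8) (c 9) (by
    intro j
    rw [← h1 j]
    simp only [Fin.sum_univ_succ, Fin.sum_univ_zero]
    simp only [add_zero, ← add_assoc]
    rfl)
  obtain ⟨e0, e2, e3, e4, e5, e6, e7, e8, e9⟩ := h4
  rw [Submodule.mem_span_singleton]
  refine ⟨c 1, ?_⟩
  rw [← hc, ← map_smul]
  congr 1
  have : ∑ i, c i • mon (T i) = c 0 • mon (T 0) + c 1 • mon (T 1) + c 2 • mon (T 2) +
      c 3 • mon (T 3) + c 4 • mon (T 4) + c 5 • mon (T 5) + c 6 • mon (T 6) + c 7 • mon (T 7) +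
      c 8 • mon (T 8) + c 9 • mon (T 9) := by
    simp only [Fin.sum_univ_succ, Fin.sum_univ_zero]
    simp only [add_zero, ← add_assoc]
    rfl
  rw [this, e0, e2, e3, e4, e5, e6, e7, e8, e9]
  simp only [zero_smul, add_zero, zero_add, ← smul_add]
  rfl

lemma p16_mem : (hitS 5).mkQ p16 ∈ invSub M16 := by
  refine ⟨?_, p16, rfl, p16_inv⟩
  rw [p16_eq]
  exact mem_M_list _ (by decide)

lemma p16_ne : (hitS 5).mkQ p16 ≠ 0 := by
  intro h
  rw [← map_zero (hitS 5).mkQ] at h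
  have h1 := phi_mkQ h
  have h2 : phi p16 = val ![1,1,2,4,2] + val ![1,2,1,2,4] + val ![1,2,1,4,2]
      + val ![1,2,4,1,2] := by
    rw [p16, map_add, map_add, map_add, ← phi_mon, ← phi_mon, ← phi_mon, ← phi_mon]
  rw [h2, map_zero] at h1
  revert h1
  decide +kernel

end S16

/-- `M16` is stable under the action of `Σ_5`, and its `Σ_5`-invariant
subspace is one-dimensional, spanned by the class of `p16`. -/
theorem statement16 :
    (∀ σ : Equiv.Perm (Fin 5), ∀ f : P 5,
        (hitS 5).mkQ f ∈ M16 → (hitS 5).mkQ (rename (⇑σ) f) ∈ M16) ∧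
    Module.finrank (ZMod 2) ↥(invSub M16) = 1 ∧
    invSub M16 = Submodule.span (ZMod 2) {(hitS 5).mkQ p16} := by
  have he : invSub M16 = Submodule.span (ZMod 2) {(hitS 5).mkQ p16} :=
    le_antisymm S16.inv_le ((Submodule.span_singleton_le_iff_mem _ _).2 S16.p16_mem)
  refine ⟨S16.stable, ?_, he⟩
  rw [he]
  exact finrank_span_singleton S16.p16_ne
end
end
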